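/- arXiv:math/0302287 — 2 statements merged into one kernel-verified Lean document; each statement's English description precedes it below -/
import Mathlib

section
/- (Linear symmetries of the focus-focus component.) On ℝ⁴ with coordinates (x_1,y_1,x_2,y_2) and standard symplectic form ω = dx_1∧dy_1 + dx_2∧dy_2, consider the focus-focus pair of quadratic functions q_1 = x_1 y_2 − x_2 y_1 and q_2 = x_1 y_1 + x_2 y_2. Then the group G = {A ∈ GL(4,ℝ) : A symplectic, q_1∘A = q_1 and q_2∘A = q_2} is a closed connected abelian subgroup of GL(4,ℝ), equal to {exp(s J S_1 + t J S_2) : s, t ∈ ℝ} where S_1, S_2 are the symmetric matrices with q_i(z) = ½ zᵀ S_i z and J is the standard symplectic matrix, and G is isomorphic as a topological group to ℝ × SO(2,ℝ). -/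
open scoped Matrix

/-- The standard symplectic `4 × 4` matrix, in coordinates `(x₁, y₁, x₂, y₂)`,
so that `ω(u,v) = uᵀ J v = dx₁∧dy₁ + dx₂∧dy₂` applied to `(u,v)`. -/
def J4 : Matrix (Fin 4) (Fin 4) ℝ :=
  !![0, 1, 0, 0; -1, 0, 0, 0; 0, 0, 0, 1; 0, 0, -1, 0]

/-- The focus-focus function `q₁ = x₁ y₂ − x₂ y₁` on `ℝ⁴` with coordinates
`(x₁, y₁, x₂, y₂) = (v 0, v 1, v 2, v 3)`. -/
def ffQ1 (v : Fin 4 → ℝ) : ℝ := v 0 * v 3 - v 2 * v 1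

/-- The focus-focus function `q₂ = x₁ y₁ + x₂ y₂`. -/
def ffQ2 (v : Fin 4 → ℝ) : ℝ := v 0 * v 1 + v 2 * v 3

/-- The symmetric matrix `S₁` with `q₁(z) = ½ zᵀ S₁ z`. -/
def ffS1 : Matrix (Fin 4) (Fin 4) ℝ :=
  !![0, 0, 0, 1; 0, 0, -1, 0; 0, -1, 0, 0; 1, 0, 0, 0]

/-- The symmetric matrix `S₂` with `q₂(z) = ½ zᵀ S₂ z`. -/
def ffS2 : Matrix (Fin 4) (Fin 4) ℝ :=
  !![0, 1, 0, 0; 1, 0, 0, 0; 0, 0, 0, 1; 0, 0, 1, 0]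

/-- The group `G` of invertible linear maps of `ℝ⁴` that are symplectic and preserve the
focus-focus pair `q₁, q₂` (as a set of matrices). -/
def ffG : Set (Matrix (Fin 4) (Fin 4) ℝ) :=
  {A | IsUnit A ∧
    (∀ u v : Fin 4 → ℝ, (A.mulVec u) ⬝ᵥ (J4.mulVec (A.mulVec v)) = u ⬝ᵥ (J4.mulVec v)) ∧
    (∀ v : Fin 4 → ℝ, ffQ1 (A.mulVec v) = ffQ1 v) ∧
    (∀ v : Fin 4 → ℝ, ffQ2 (A.mulVec v) = ffQ2 v)}

open scoped ComplexConjugate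

/-- The block action of a pair `(z, w)` of complex numbers on `ℝ⁴ = ℂ × ℂ`, where `z` multiplies
`x₁ + i x₂` and `w` multiplies `y₁ + i y₂`. -/
noncomputable def complexPairMatrix : ℂ × ℂ →ₐ[ℝ] Matrix (Fin 4) (Fin 4) ℝ :=
  AlgHom.ofLinearMap
    { toFun := fun p =>
        !![p.1.re, 0, -p.1.im, 0; 0, p.2.re, 0, -p.2.im; p.1.im, 0, p.1.re, 0; 0, p.2.im, 0, p.2.re]
      map_add' := fun p q => by
        ext i j
        fin_cases i <;> fin_cases j <;> simp [add_comm]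
      map_smul' := fun r p => by
        ext i j
        fin_cases i <;> fin_cases j <;> simp }
    (by
      ext i j
      fin_cases i <;> fin_cases j <;> simp)
    (fun p q => by
      ext i j
      fin_cases i <;> fin_cases j <;> simp [Matrix.mul_apply, Fin.sum_univ_four] <;> ring)

lemma complexPairMatrix_apply (p : ℂ × ℂ) :
    complexPairMatrix p =
      !![p.1.re, 0, -p.1.im, 0; 0, p.2.re, 0, -p.2.im;
        p.1.im, 0, p.1.re, 0; 0, p.2.im, 0, p.2.re] :=
  rfl

lemma complexPairMatrix_injective : Function.Injective complexPairMatrix := by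
  intro p q h
  rw [complexPairMatrix_apply, complexPairMatrix_apply] at h
  have h₀₀ := congrFun₂ h 0 0
  have h₂₀ := congrFun₂ h 2 0
  have h₁₁ := congrFun₂ h 1 1
  have h₃₁ := congrFun₂ h 3 1
  simp at h₀₀ h₂₀ h₁₁ h₃₁
  exact Prod.ext (Complex.ext h₀₀ h₂₀) (Complex.ext h₁₁ h₃₁)

lemma complexPairMatrix_isClosedEmbedding : Topology.IsClosedEmbedding complexPairMatrix :=
  complexPairMatrix.toLinearMap.isClosedEmbedding_of_injective
    (LinearMap.ker_eq_bot.2 complexPairMatrix_injective)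

/-- The infinitesimal generators act diagonally in the complex coordinates. -/
lemma smul_J4_mul_ffS1_add_smul_J4_mul_ffS2 (c : ℂ) :
    c.im • (J4 * ffS1) + c.re • (J4 * ffS2) = complexPairMatrix (c, -conj c) := by
  rw [complexPairMatrix_apply]
  ext i j
  fin_cases i <;> fin_cases j <;> simp [J4, ffS1, ffS2]

lemma exp_complexPairMatrix (p : ℂ × ℂ) :
    NormedSpace.exp (complexPairMatrix p) =
      complexPairMatrix (Complex.exp p.1, Complex.exp p.2) := by
  have hp : NormedSpace.exp p = (Complex.exp p.1, Complex.exp p.2) := by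
    ext1 <;> simp [Complex.exp_eq_exp_ℂ]
  rw [← hp]
  open scoped Matrix.Norms.Operator in
  exact (NormedSpace.map_exp complexPairMatrix
    complexPairMatrix_isClosedEmbedding.continuous p).symm

lemma dotProduct_ffS1_mulVec (u v : Fin 4 → ℝ) :
    u ⬝ᵥ ffS1 *ᵥ v = ffQ1 (u + v) - ffQ1 u - ffQ1 v := by
  simp [ffS1, ffQ1, Matrix.mulVec, dotProduct, Fin.sum_univ_four]
  ring

lemma dotProduct_ffS2_mulVec (u v : Fin 4 → ℝ) :
    u ⬝ᵥ ffS2 *ᵥ v = ffQ2 (u + v) - ffQ2 u - ffQ2 v := by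
  simp [ffS2, ffQ2, Matrix.mulVec, dotProduct, Fin.sum_univ_four]
  ring

lemma transpose_mul_mul_eq_of_dotProduct {n : Type*} [Fintype n] [DecidableEq n]
    {A S : Matrix n n ℝ} (h : ∀ u v, A *ᵥ u ⬝ᵥ S *ᵥ A *ᵥ v = u ⬝ᵥ S *ᵥ v) : Aᵀ * S * A = S := by
  refine Matrix.ext_of_mulVec_single fun j => dotProduct_eq _ _ fun u => ?_
  rw [dotProduct_comm, dotProduct_comm _ u, ← h, ← Matrix.mulVec_mulVec, ← Matrix.mulVec_mulVec,
    Matrix.dotProduct_mulVec, Matrix.vecMul_transpose]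

lemma J4_mul_J4 : J4 * J4 = -1 := by
  ext i j
  fin_cases i <;> fin_cases j <;> simp [J4, Matrix.mul_apply, Fin.sum_univ_four]

/-- A symplectic matrix preserving a quadratic form commutes with its Hamiltonian matrix. -/
lemma commute_J4_mul {A S : Matrix (Fin 4) (Fin 4) ℝ} (hA : IsUnit A) (hJ : Aᵀ * J4 * A = J4)
    (hS : Aᵀ * S * A = S) : A * (J4 * S) = J4 * S * A := by
  have key : Aᵀ * (J4 * (A * (J4 * S))) = Aᵀ * (-(S * A)) := by
    calc Aᵀ * (J4 * (A * (J4 * S))) = (Aᵀ * J4 * A) * (J4 * S) := by simp only [mul_assoc]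
      _ = (J4 * J4) * S := by rw [hJ, mul_assoc]
      _ = -(Aᵀ * S * A) := by rw [J4_mul_J4, hS, neg_one_mul]
      _ = Aᵀ * (-(S * A)) := by rw [mul_neg, mul_assoc]
  have hcancel := (A.isUnit_transpose.2 hA).mul_left_cancel key
  have := congrArg (J4 * ·) hcancel
  simp only [← mul_assoc, J4_mul_J4] at this
  simpa [mul_assoc] using this

lemma exists_eq_complexPairMatrix {A : Matrix (Fin 4) (Fin 4) ℝ}
    (h₁ : A * (J4 * ffS1) = J4 * ffS1 * A) (h₂ : A * (J4 * ffS2) = J4 * ffS2 * A) :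
    ∃ p, A = complexPairMatrix p := by
  refine ⟨(⟨A 0 0, A 2 0⟩, ⟨A 1 1, A 3 1⟩), ?_⟩
  have e₁ := fun i j => congrFun₂ h₁ i j
  have e₂ := fun i j => congrFun₂ h₂ i j
  simp [J4, ffS1, ffS2, Matrix.mul_apply, Fin.sum_univ_four, Fin.forall_fin_succ] at e₁ e₂
  rw [complexPairMatrix_apply]
  ext i j
  fin_cases i <;> fin_cases j <;> simp <;> grind

lemma complexPairMatrix_mem_ffG_iff (p : ℂ × ℂ) :
    complexPairMatrix p ∈ ffG ↔ conj p.1 * p.2 = 1 := by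
  obtain ⟨⟨a, b⟩, ⟨c, d⟩⟩ := p
  constructor
  · rintro ⟨-, -, h₁, h₂⟩
    specialize h₁ ![1, 1, 0, 0]
    specialize h₂ ![1, 1, 0, 0]
    simp [complexPairMatrix_apply, ffQ1, ffQ2, Matrix.mulVec, dotProduct, Fin.sum_univ_four]
      at h₁ h₂
    apply Complex.ext <;> simp <;> linarith
  · intro h
    have hre := congrArg Complex.re h
    have him := congrArg Complex.im h
    simp at hre him
    refine ⟨?_, fun u v => ?_, fun v => ?_, fun v => ?_⟩
    · refine IsUnit.map complexPairMatrix (Prod.isUnit_iff.2 ⟨?_, ?_⟩)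
      · rw [isUnit_iff_ne_zero]
        exact fun h0 => by simp [show (⟨a, b⟩ : ℂ) = 0 from h0] at h
      · exact IsUnit.of_mul_eq_one_right _ h
    · simp [complexPairMatrix_apply, J4, Matrix.mulVec, dotProduct, Fin.sum_univ_four]
      linear_combination (u 0 * v 1 - u 1 * v 0 + u 2 * v 3 - u 3 * v 2) * hre +
        (u 2 * v 1 - u 0 * v 3 + u 3 * v 0 - u 1 * v 2) * him
    · simp [complexPairMatrix_apply, ffQ1, Matrix.mulVec, dotProduct, Fin.sum_univ_four]
      linear_combination (v 0 * v 3 - v 2 * v 1) * hre + (v 0 * v 1 + v 2 * v 3) * him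
    · simp [complexPairMatrix_apply, ffQ2, Matrix.mulVec, dotProduct, Fin.sum_univ_four]
      linear_combination (v 0 * v 1 + v 2 * v 3) * hre - (v 0 * v 3 - v 2 * v 1) * him

lemma ffG_eq_image : ffG = complexPairMatrix '' {p | conj p.1 * p.2 = 1} := by
  ext A
  constructor
  · intro hA
    obtain ⟨hu, hJ, h₁, h₂⟩ := id hA
    have hJ' := transpose_mul_mul_eq_of_dotProduct hJ
    have hS₁ : Aᵀ * ffS1 * A = ffS1 := transpose_mul_mul_eq_of_dotProduct fun u v => by
      simp only [dotProduct_ffS1_mulVec, ← Matrix.mulVec_add, h₁]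
    have hS₂ : Aᵀ * ffS2 * A = ffS2 := transpose_mul_mul_eq_of_dotProduct fun u v => by
      simp only [dotProduct_ffS2_mulVec, ← Matrix.mulVec_add, h₂]
    obtain ⟨p, rfl⟩ := exists_eq_complexPairMatrix (commute_J4_mul hu hJ' hS₁)
      (commute_J4_mul hu hJ' hS₂)
    exact ⟨p, (complexPairMatrix_mem_ffG_iff p).1 hA, rfl⟩
  · rintro ⟨p, hp, rfl⟩
    exact (complexPairMatrix_mem_ffG_iff p).2 hp

lemma ffG_eq_range_exp :
    ffG = Set.range fun c : ℂ => NormedSpace.exp (complexPairMatrix (c, -conj c)) := by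
  simp only [exp_complexPairMatrix, ffG_eq_image]
  ext A
  constructor
  · rintro ⟨⟨z, w⟩, hp, rfl⟩
    have hz : z ≠ 0 := by
      rintro rfl
      simp at hp
    refine ⟨Complex.log z, ?_⟩
    simp only [Complex.exp_neg, Complex.exp_conj, Complex.exp_log hz]
    rw [← (eq_inv_of_mul_eq_one_right hp : w = _)]
  · rintro ⟨c, rfl⟩
    exact ⟨_, by simp [← Complex.exp_conj, ← Complex.exp_add], rfl⟩

/-- The complex number representing a plane rotation. -/
def rotationToComplex (Q : Matrix.specialOrthogonalGroup (Fin 2) ℝ) : ℂ :=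
  ⟨Q.1 0 0, Q.1 1 0⟩

lemma specialOrthogonalGroup_fin_two_entries (Q : Matrix.specialOrthogonalGroup (Fin 2) ℝ) :
    Q.1 0 1 = -Q.1 1 0 ∧ Q.1 1 1 = Q.1 0 0 ∧ Q.1 0 0 ^ 2 + Q.1 1 0 ^ 2 = 1 := by
  obtain ⟨h₁, h₂, h₃⟩ := Matrix.mem_specialOrthogonalGroup_fin_two_iff.1 Q.2
  exact ⟨h₂, h₁.symm, by rw [← h₃, h₂, neg_sq]⟩

lemma rotationToComplex_mul (P Q : Matrix.specialOrthogonalGroup (Fin 2) ℝ) :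
    rotationToComplex (P * Q) = rotationToComplex P * rotationToComplex Q := by
  obtain ⟨h₁, h₂, -⟩ := specialOrthogonalGroup_fin_two_entries P
  apply Complex.ext <;>
    simp [rotationToComplex, Matrix.mul_apply, Fin.sum_univ_two, h₁, h₂] <;> ring

lemma norm_rotationToComplex (Q : Matrix.specialOrthogonalGroup (Fin 2) ℝ) :
    ‖rotationToComplex Q‖ = 1 := by
  rw [← sq_eq_sq₀ (norm_nonneg _) zero_le_one, Complex.sq_norm, Complex.normSq_apply]
  simp only [rotationToComplex]
  linear_combination (specialOrthogonalGroup_fin_two_entries Q).2.2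

lemma continuous_rotationToComplex : Continuous rotationToComplex := by
  have h : rotationToComplex = fun Q => Complex.equivRealProdCLM.symm (Q.1 0 0, Q.1 1 0) := rfl
  rw [h]
  exact Complex.equivRealProdCLM.symm.continuous.comp
    ((continuous_subtype_val.matrix_elem 0 0).prodMk (continuous_subtype_val.matrix_elem 1 0))

/-- The real `2 × 2` matrix of multiplication by a complex number. -/
def complexToMatrix (z : ℂ) : Matrix (Fin 2) (Fin 2) ℝ :=
  !![z.re, -z.im; z.im, z.re]

lemma complexToMatrix_rotationToComplex (Q : Matrix.specialOrthogonalGroup (Fin 2) ℝ) :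
    complexToMatrix (rotationToComplex Q) = Q.1 := by
  obtain ⟨h₁, h₂, -⟩ := specialOrthogonalGroup_fin_two_entries Q
  ext i j
  fin_cases i <;> fin_cases j <;> simp [complexToMatrix, rotationToComplex, h₁, h₂]

lemma exists_rotationToComplex_eq {z : ℂ} (hz : ‖z‖ = 1) : ∃ Q, rotationToComplex Q = z := by
  have h : z.re * z.re + z.im * z.im = 1 := by
    rw [← Complex.normSq_apply, ← Complex.sq_norm, hz, one_pow]
  refine ⟨⟨complexToMatrix z, Matrix.of_mem_specialOrthogonalGroup_fin_two_iff.2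
    ⟨rfl, rfl, by linarith⟩⟩, ?_⟩
  apply Complex.ext <;> simp [rotationToComplex, complexToMatrix]

/-- The pair of complex multipliers attached to a scaling parameter and a rotation. -/
noncomputable def scaledRotation
    (a : Multiplicative ℝ × Matrix.specialOrthogonalGroup (Fin 2) ℝ) : ℂ × ℂ :=
  (Real.exp a.1.toAdd * rotationToComplex a.2, Real.exp (-a.1.toAdd) * rotationToComplex a.2)

lemma scaledRotation_mul (a b : Multiplicative ℝ × Matrix.specialOrthogonalGroup (Fin 2) ℝ) :
    scaledRotation (a * b) = scaledRotation a * scaledRotation b := by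
  simp only [scaledRotation, Prod.fst_mul, Prod.snd_mul, rotationToComplex_mul, toAdd_mul, neg_add,
    Real.exp_add, Complex.ofReal_mul, Prod.mk_mul_mk]
  congr 1 <;> ring

lemma range_scaledRotation : Set.range scaledRotation = {p | conj p.1 * p.2 = 1} := by
  ext p
  constructor
  · rintro ⟨a, rfl⟩
    have hu : conj (rotationToComplex a.2) * rotationToComplex a.2 = 1 := by
      rw [Complex.conj_mul', norm_rotationToComplex]
      simp
    have hr : (Real.exp a.1.toAdd : ℂ) * Real.exp (-a.1.toAdd) = 1 := by
      rw [← Complex.ofReal_mul, ← Real.exp_add]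
      simp
    simp only [scaledRotation, Set.mem_ofPred_eq, map_mul, Complex.conj_ofReal]
    linear_combination hr * (conj (rotationToComplex a.2) * rotationToComplex a.2) + hu
  · obtain ⟨z, w⟩ := p
    intro (hp : conj z * w = 1)
    have hz : z ≠ 0 := by
      rintro rfl
      simp at hp
    have hn : (‖z‖ : ℂ) ≠ 0 := by simpa using hz
    obtain ⟨Q, hQ⟩ := exists_rotationToComplex_eq (z := z / ‖z‖) (by simp [hz])
    refine ⟨(Multiplicative.ofAdd (Real.log ‖z‖), Q), ?_⟩
    simp only [scaledRotation, hQ, toAdd_ofAdd, Real.exp_neg, Real.exp_log (norm_pos_iff.2 hz)]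
    refine Prod.ext ?_ ?_
    · field_simp
    · have hsq := Complex.conj_mul' z
      have hw : (‖z‖ : ℂ) ^ 2 * w = z := by
        rw [← hsq]
        linear_combination z * hp
      push_cast
      field_simp
      exact hw.symm

lemma scaledRotation_isEmbedding : Topology.IsEmbedding scaledRotation := by
  let r : ℂ × ℂ → ℝ := fun p => Real.arsinh ((‖p.1‖ - ‖p.2‖) / 2)
  let g : ℂ × ℂ → Multiplicative ℝ × Matrix (Fin 2) (Fin 2) ℝ := fun p =>
    (Multiplicative.ofAdd (r p), complexToMatrix (Real.exp (-r p) * p.1))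
  have hr : ∀ a, r (scaledRotation a) = a.1.toAdd := fun a => by
    simp only [r, scaledRotation, norm_mul, norm_rotationToComplex, mul_one, Complex.norm_real,
      Real.norm_eq_abs, Real.abs_exp]
    rw [← Real.sinh_eq, Real.arsinh_sinh]
  have hg : g ∘ scaledRotation = Prod.map id Subtype.val := by
    funext a
    refine Prod.ext ?_ ?_
    · simp [g, hr]
    · simp only [g, Function.comp_apply, hr, Prod.map_snd]
      rw [← complexToMatrix_rotationToComplex, scaledRotation, ← mul_assoc, ← Complex.ofReal_mul,
        ← Real.exp_add]
      simp
  have hf : Continuous scaledRotation := by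
    have h₁ := continuous_rotationToComplex.comp (continuous_snd (X := Multiplicative ℝ))
    have h₂ : Continuous fun a : Multiplicative ℝ × Matrix.specialOrthogonalGroup (Fin 2) ℝ =>
        a.1.toAdd := continuous_toAdd.comp continuous_fst
    exact ((Complex.continuous_ofReal.comp (Real.continuous_exp.comp h₂)).mul h₁).prodMk
      ((Complex.continuous_ofReal.comp (Real.continuous_exp.comp h₂.neg)).mul h₁)
  have hrc : Continuous r := Real.continuous_arsinh.comp (by fun_prop)
  have hM : Continuous complexToMatrix := by
    refine continuous_matrix fun i j => ?_
    fin_cases i <;> fin_cases j <;> simp [complexToMatrix] <;> fun_prop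
  have hgc : Continuous g :=
    (continuous_ofAdd.comp hrc).prodMk (hM.comp (by fun_prop))
  refine Topology.IsEmbedding.of_comp hf hgc ?_
  rw [hg]
  exact Topology.IsEmbedding.id.prodMap Topology.IsEmbedding.subtypeVal

/-- Linear symmetries of the focus-focus component: the group
`G = {A ∈ GL(4,ℝ) : A symplectic, q₁∘A = q₁, q₂∘A = q₂}` is a closed connected abelian
subgroup of `GL(4,ℝ)`, equal to `{exp(s J S₁ + t J S₂) : s, t ∈ ℝ}`, and is isomorphic
as a topological group to `ℝ × SO(2,ℝ)`. -/
theorem focusfocus_linear_symmetries :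
    ((1 : Matrix (Fin 4) (Fin 4) ℝ) ∈ ffG ∧
      (∀ A ∈ ffG, ∀ B ∈ ffG, A * B ∈ ffG) ∧
      (∀ A ∈ ffG, ∃ B ∈ ffG, A * B = 1 ∧ B * A = 1)) ∧
    IsClosed ffG ∧ IsConnected ffG ∧
    (∀ A ∈ ffG, ∀ B ∈ ffG, A * B = B * A) ∧
    ffG = {M | ∃ s t : ℝ, M = NormedSpace.exp (s • (J4 * ffS1) + t • (J4 * ffS2))} ∧
    ∃ e : Multiplicative ℝ × Matrix.specialOrthogonalGroup (Fin 2) ℝ →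
        Matrix (Fin 4) (Fin 4) ℝ,
      (∀ a b, e (a * b) = e a * e b) ∧ Function.Injective e ∧
        Set.range e = ffG ∧ Topology.IsEmbedding e := by
  have hexp : ∀ c d : ℂ, NormedSpace.exp (complexPairMatrix (c, -conj c)) *
      NormedSpace.exp (complexPairMatrix (d, -conj d)) =
      NormedSpace.exp (complexPairMatrix (c + d, -conj (c + d))) := fun c d => by
    simp only [exp_complexPairMatrix, ← map_mul, Prod.mk_mul_mk, ← Complex.exp_add, map_add,
      neg_add]
  have hzero : NormedSpace.exp (complexPairMatrix ((0 : ℂ), -conj (0 : ℂ))) = 1 := by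
    rw [map_zero, neg_zero, ← Prod.zero_eq_mk, map_zero, NormedSpace.exp_zero]
  refine ⟨⟨?_, ?_, ?_⟩, ?_, ?_, ?_, ?_, complexPairMatrix ∘ scaledRotation, fun a b => ?_, ?_, ?_,
    ?_⟩
  · rw [ffG_eq_range_exp]
    exact ⟨0, hzero⟩
  · rw [ffG_eq_range_exp]
    rintro _ ⟨c, rfl⟩ _ ⟨d, rfl⟩
    exact ⟨c + d, (hexp c d).symm⟩
  · rw [ffG_eq_range_exp]
    rintro _ ⟨c, rfl⟩
    refine ⟨_, ⟨-c, rfl⟩, ?_, ?_⟩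
    · rw [hexp, add_neg_cancel, hzero]
    · rw [hexp, neg_add_cancel, hzero]
  · rw [ffG_eq_image]
    refine complexPairMatrix_isClosedEmbedding.isClosedMap _ (isClosed_eq ?_ continuous_const)
    fun_prop
  · rw [ffG_eq_range_exp]
    refine isConnected_range ?_
    simp only [exp_complexPairMatrix]
    exact complexPairMatrix_isClosedEmbedding.continuous.comp (by fun_prop)
  · rw [ffG_eq_range_exp]
    rintro _ ⟨c, rfl⟩ _ ⟨d, rfl⟩
    simp only [hexp, add_comm]
  · rw [ffG_eq_range_exp]
    ext M
    constructor
    · rintro ⟨c, rfl⟩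
      exact ⟨c.im, c.re, by rw [smul_J4_mul_ffS1_add_smul_J4_mul_ffS2]⟩
    · rintro ⟨s, t, rfl⟩
      exact ⟨⟨t, s⟩, congrArg _ (smul_J4_mul_ffS1_add_smul_J4_mul_ffS2 ⟨t, s⟩).symm⟩
  · simp only [Function.comp_apply, scaledRotation_mul, map_mul]
  · exact complexPairMatrix_injective.comp scaledRotation_isEmbedding.injective
  · rw [Set.range_comp, range_scaledRotation, ffG_eq_image]
  · exact complexPairMatrix_isClosedEmbedding.isEmbedding.comp scaledRotation_isEmbedding
end

section
/- (Equivariant linearization of a compact symmetry group at a nondegenerate fixed point, preserving the system.) Let n = k_e + k_h + 2k_f and let h : ℝ^{2n} → ℝ^n be the model moment map of Williamson type (k_e,k_h,k_f). Let G be a compact Lie group and ρ : G × ℝ^{2n} → ℝ^{2n} a smooth action of G on ℝ^{2n} such that for every g ∈ G: ρ(g)(0) = 0, the derivative D(ρ(g))(z) is symplectic for every z, and h∘ρ(g) = h. Then there exist ε > 0 and a smooth map Φ from the open ball B(0,ε) ⊂ ℝ^{2n} into ℝ^{2n} with Φ(0) = 0, Φ a diffeomorphism onto its image, DΦ(z)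 symplectic for every z ∈ B(0,ε), h∘Φ = h on B(0,ε), and Φ(ρ(g)(z)) = D(ρ(g))(0)(Φ(z)) for every g ∈ G and every z ∈ B(0,ε) with ρ(g)(z) ∈ B(0,ε). That is, Φ is a local system-preserving symplectic change of variables under which the action of G becomes linear. -/
open scoped BigOperators

/-- The standard symplectic form `ω = Σ_i dx_i ∧ dy_i` on `ℝ^{2n}`, modeled as
`Fin n → ℝ × ℝ` with `(x_i, y_i) = z i`. -/
def symplForm {n : ℕ} (u v : Fin n → ℝ × ℝ) : ℝ :=
  ∑ i : Fin n, ((u i).1 * (v i).2 - (u i).2 * (v i).1)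

/-- A continuous linear map on `ℝ^{2n}` is symplectic if it preserves `ω`. -/
def IsSymplecticCLM {n : ℕ} (A : (Fin n → ℝ × ℝ) →L[ℝ] (Fin n → ℝ × ℝ)) : Prop :=
  ∀ u v, symplForm (A u) (A v) = symplForm u v

/-- The `i`-th component of the model moment map of Williamson type `(k_e, k_h, k_f)`
(with `n = k_e + k_h + 2 k_f`): elliptic components `x_i² + y_i²` for `i < k_e`,
hyperbolic components `x_i y_i` for `k_e ≤ i < k_e + k_h`, and focus-focus pairs
`x_i y_{i+1} − x_{i+1} y_i`, `x_i y_i + x_{i+1} y_{i+1}` for the remaining indices,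
grouped in consecutive pairs.  (Indices are 0-based.) -/
def williamson (ke kh : ℕ) {n : ℕ} (i : Fin n) (z : Fin n → ℝ × ℝ) : ℝ :=
  let x : ℕ → ℝ := fun j => if h : j < n then (z ⟨j, h⟩).1 else 0
  let y : ℕ → ℝ := fun j => if h : j < n then (z ⟨j, h⟩).2 else 0
  if i.val < ke then x i.val ^ 2 + y i.val ^ 2
  else if i.val < ke + kh then x i.val * y i.val
  else if (i.val - (ke + kh)) % 2 = 0 then
    x i.val * y (i.val + 1) - x (i.val + 1) * y i.val
  else x (i.val - 1) * y (i.val - 1) + x i.val * y i.val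

section linearization

open scoped ContDiff
open Set MeasureTheory

/-- An integral over `[0, 1]` of a smooth function depends smoothly on the parameters. -/
theorem contDiff_intervalIntegral_param {V : Type} [NormedAddCommGroup V] [NormedSpace ℝ V]
    [FiniteDimensional ℝ V] (k : ℕ) :
    ∀ {W : Type} [NormedAddCommGroup W] [NormedSpace ℝ W] [FiniteDimensional ℝ W]
      {F : ℝ × V → W}, ContDiff ℝ ∞ F → ContDiff ℝ k fun z => ∫ t in (0 : ℝ)..1, F (t, z) := by
  induction k with
  | zero =>
    intro W _ _ _ F hF
    have := FiniteDimensional.complete ℝ W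
    refine contDiff_zero.2 ?_
    exact intervalIntegral.continuous_parametric_intervalIntegral_of_continuous'
      (f := fun z t => F (t, z)) (by fun_prop) 0 1
  | succ k ih =>
    intro W _ _ _ F hF
    have := FiniteDimensional.complete ℝ W
    have := FiniteDimensional.proper ℝ V
    have hF' : ContDiff ℝ ∞ fun p : ℝ × V => (fderiv ℝ F p).comp (ContinuousLinearMap.inr ℝ ℝ V) :=
      (hF.fderiv_right (m := ∞) (by simp)).clm_comp contDiff_const
    have key : ∀ z, HasFDerivAt (fun z => ∫ t in (0 : ℝ)..1, F (t, z))
        (∫ t in (0 : ℝ)..1, (fderiv ℝ F (t, z)).comp (ContinuousLinearMap.inr ℝ ℝ V)) z := by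
      intro z
      obtain ⟨C, hC⟩ := ((isCompact_Icc (a := (0 : ℝ)) (b := 1)).prod
        (isCompact_closedBall z 1)).exists_bound_of_continuousOn hF'.continuous.continuousOn
      refine intervalIntegral.hasFDerivAt_integral_of_dominated_of_fderiv_le
        (F' := fun z t => (fderiv ℝ F (t, z)).comp (ContinuousLinearMap.inr ℝ ℝ V))
        (bound := fun _ => C) (Metric.ball_mem_nhds z one_pos) ?_ ?_ ?_ ?_ ?_ ?_
      · refine Filter.Eventually.of_forall fun w => ?_
        have : Continuous fun t => F (t, w) := hF.continuous.comp (by fun_prop)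
        exact this.aestronglyMeasurable
      · have : Continuous fun t => F (t, z) := hF.continuous.comp (by fun_prop)
        exact this.intervalIntegrable _ _
      · have : Continuous fun t : ℝ => (fderiv ℝ F (t, z)).comp (ContinuousLinearMap.inr ℝ ℝ V) :=
          hF'.continuous.comp (g := fun p : ℝ × V =>
            (fderiv ℝ F p).comp (ContinuousLinearMap.inr ℝ ℝ V)) (f := fun t : ℝ => (t, z))
            (by fun_prop)
        exact this.aestronglyMeasurable
      · refine Filter.Eventually.of_forall fun t ht x hx => ?_
        rw [uIoc_of_le zero_le_one] at ht
        exact hC (t, x) ⟨⟨ht.1.le, ht.2⟩, Metric.ball_subset_closedBall hx⟩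
      · exact intervalIntegrable_const
      · refine Filter.Eventually.of_forall fun t _ x _ => ?_
        have h1 : HasFDerivAt F (fderiv ℝ F (t, x)) (t, x) :=
          (hF.differentiable (by simp) _).hasFDerivAt
        exact h1.comp x (hasFDerivAt_prodMk_right t x)
    rw [Nat.cast_succ, contDiff_succ_iff_fderiv]
    refine ⟨fun z => (key z).differentiableAt, by simp, ?_⟩
    rw [show fderiv ℝ (fun z => ∫ t in (0 : ℝ)..1, F (t, z)) = fun z => _ from
      funext fun z => (key z).fderiv]
    exact ih hF'

theorem contDiff_infty_intervalIntegral_param {V W : Type} [NormedAddCommGroup V]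
    [NormedSpace ℝ V] [FiniteDimensional ℝ V] [NormedAddCommGroup W] [NormedSpace ℝ W]
    [FiniteDimensional ℝ W] {F : ℝ × V → W} (hF : ContDiff ℝ ∞ F) :
    ContDiff ℝ ∞ fun z => ∫ t in (0 : ℝ)..1, F (t, z) :=
  contDiff_infty.2 fun k => contDiff_intervalIntegral_param k hF

/-- Hadamard's lemma: a smooth function vanishing on `{0} × V` is divisible by the first
coordinate. -/
theorem exists_contDiff_eq_smul {V W : Type} [NormedAddCommGroup V]
    [NormedSpace ℝ V] [FiniteDimensional ℝ V] [NormedAddCommGroup W] [NormedSpace ℝ W]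
    [FiniteDimensional ℝ W] {f : ℝ × V → W} (hf : ContDiff ℝ ∞ f) (h0 : ∀ z, f (0, z) = 0) :
    ∃ g : ℝ × V → W, ContDiff ℝ ∞ g ∧ ∀ x z, f (x, z) = x • g (x, z) := by
  have := FiniteDimensional.complete ℝ W
  have hf' : ContDiff ℝ ∞ (fderiv ℝ f) := hf.fderiv_right (by simp)
  refine ⟨fun p => ∫ t in (0 : ℝ)..1, fderiv ℝ f (t * p.1, p.2) (1, 0), ?_, fun x z => ?_⟩
  · exact contDiff_infty_intervalIntegral_param
      (F := fun q : ℝ × (ℝ × V) => fderiv ℝ f (q.1 * q.2.1, q.2.2) (1, 0))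
      ((hf'.comp (by fun_prop)).clm_apply contDiff_const)
  · have hd : ∀ t : ℝ, HasDerivAt (fun t : ℝ => f (t * x, z))
        (x • fderiv ℝ f (t * x, z) (1, 0)) t := fun t => by
      have h1 : HasFDerivAt f (fderiv ℝ f (t * x, z)) (t * x, z) :=
        (hf.differentiable (by simp) _).hasFDerivAt
      have h2 : HasDerivAt (fun t : ℝ => (t * x, z)) (x • ((1 : ℝ), (0 : V))) t := by
        have := ((hasDerivAt_id t).mul_const x).prodMk (hasDerivAt_const t z)
        simpa using this
      have := h1.comp_hasDerivAt t h2
      rwa [map_smul] at this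
    have hc : Continuous fun t : ℝ => x • fderiv ℝ f (t * x, z) (1, 0) := by
      have : Continuous fun t : ℝ => fderiv ℝ f (t * x, z) := hf'.continuous.comp (by fun_prop)
      fun_prop
    have := intervalIntegral.integral_eq_sub_of_hasDerivAt (fun t _ => hd t)
      (hc.intervalIntegrable 0 1)
    rw [intervalIntegral.integral_smul] at this
    simp [h0] at this
    exact this.symm

/-- Whitney's theorem on even functions, in the form: a smooth function `g (x, z)` that is even in
`x` gives a smooth function `g (‖c‖, z)` on `ℂ × V`. -/
theorem contDiff_comp_norm_of_even {V : Type} [NormedAddCommGroup V] [NormedSpace ℝ V]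
    [FiniteDimensional ℝ V] (k : ℕ) :
    ∀ {W : Type} [NormedAddCommGroup W] [NormedSpace ℝ W] [FiniteDimensional ℝ W]
      {g : ℝ × V → W}, ContDiff ℝ ∞ g → (∀ x z, g (-x, z) = g (x, z)) →
      ContDiff ℝ k fun p : ℂ × V => g (‖p.1‖, p.2) := by
  induction k with
  | zero =>
    intro W _ _ _ g hg _
    exact contDiff_zero.2 (hg.continuous.comp (by fun_prop))
  | succ k ih =>
    intro W _ _ _ g hg heven
    have hg' : ContDiff ℝ ∞ (fderiv ℝ g) := hg.fderiv_right (by simp)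
    have hgd : ∀ p, HasFDerivAt g (fderiv ℝ g p) p := fun p =>
      (hg.differentiable (by simp) p).hasFDerivAt
    let R : ℝ × V →L[ℝ] ℝ × V :=
      (-ContinuousLinearMap.fst ℝ ℝ V).prod (ContinuousLinearMap.snd ℝ ℝ V)
    have hR : ∀ x z, fderiv ℝ g (x, z) = (fderiv ℝ g (-x, z)).comp R := fun x z => by
      have h1 : HasFDerivAt (g ∘ R) ((fderiv ℝ g (R (x, z))).comp R) (x, z) :=
        (hgd _).comp _ R.hasFDerivAt
      have h2 : g ∘ R = g := by
        ext p
        exact heven p.1 p.2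
      rw [h2] at h1
      exact h1.fderiv
    have hodd : ∀ x z, fderiv ℝ g (-x, z) (1, 0) = -fderiv ℝ g (x, z) (1, 0) := fun x z => by
      rw [hR x z, ← map_neg]
      simp [R]
    have heven2 : ∀ x z v, fderiv ℝ g (-x, z) (0, v) = fderiv ℝ g (x, z) (0, v) := fun x z v => by
      rw [hR x z]
      simp [R]
    have hzero : ∀ z, fderiv ℝ g (0, z) (1, 0) = 0 := fun z => by
      have := hodd 0 z
      rw [neg_zero] at this
      have h2 : (2 : ℝ) • fderiv ℝ g (0, z) (1, 0) = 0 := by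
        rw [two_smul]
        exact eq_neg_iff_add_eq_zero.1 this
      exact (smul_eq_zero.1 h2).resolve_left two_ne_zero
    obtain ⟨g₁, hg₁, hg₁eq⟩ := exists_contDiff_eq_smul
      (f := fun p => fderiv ℝ g p (1, 0)) (hg'.clm_apply contDiff_const) hzero
    have hg₁even : ∀ x z, g₁ (-x, z) = g₁ (x, z) := fun x z => by
      rcases eq_or_ne x 0 with rfl | hx
      · simp
      · have h := hodd x z
        rw [hg₁eq, hg₁eq, neg_smul, neg_inj] at h
        exact smul_right_injective W hx h
    let g₂ : ℝ × V → V →L[ℝ] W := fun p => (fderiv ℝ g p).comp (ContinuousLinearMap.inr ℝ ℝ V)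
    have hg₂ : ContDiff ℝ ∞ g₂ := hg'.clm_comp contDiff_const
    have hg₂even : ∀ x z, g₂ (-x, z) = g₂ (x, z) := fun x z => by
      ext v
      simp [g₂, heven2]
    let D : ℂ × V → ℂ × V →L[ℝ] W := fun p =>
      ((innerSL ℝ p.1).comp (ContinuousLinearMap.fst ℝ ℂ V)).smulRight (g₁ (‖p.1‖, p.2)) +
        (g₂ (‖p.1‖, p.2)).comp (ContinuousLinearMap.snd ℝ ℂ V)
    have hsplit : ∀ (p : ℝ × V) (a : ℝ) (v : V),
        fderiv ℝ g p (a, v) = a • fderiv ℝ g p (1, 0) + fderiv ℝ g p (0, v) := fun p a v => by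
      rw [← map_smul, ← map_add]
      simp
    have key : ∀ p, HasFDerivAt (fun p : ℂ × V => g (‖p.1‖, p.2)) (D p) p := by
      rintro ⟨c, z⟩
      rcases eq_or_ne c 0 with rfl | hc
      · have hD : ∀ q : ℂ × V, D (0, z) (q - (0, z)) =
            fderiv ℝ g (0, z) ((‖q.1‖, q.2) - (0, z)) := fun q => by
          rw [Prod.mk_sub_mk, hsplit, hzero]
          simp [D, g₂]
        have h := (hasFDerivAt_iff_isLittleO.1 (hgd (0, z))).comp_tendsto
          (k := fun q : ℂ × V => (‖q.1‖, q.2)) (l' := nhds (0, z)) (by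
            have : Continuous fun q : ℂ × V => (‖q.1‖, q.2) := by fun_prop
            simpa using this.tendsto (0, z))
        rw [hasFDerivAt_iff_isLittleO]
        simp only [hD, norm_zero]
        have h3 : (fun q : ℂ × V => ((‖q.1‖, q.2) : ℝ × V) - (0, z)) =O[nhds (0, z)]
            fun q => q - (0, z) := by
          refine Asymptotics.IsBigO.of_bound 1 (Filter.Eventually.of_forall fun q => ?_)
          simp [Prod.norm_def]
        exact h.trans_isBigO h3
      · have h1 : HasFDerivAt (fun p : ℂ × V => ‖p.1‖)
            (‖c‖⁻¹ • (innerSL ℝ c).comp (ContinuousLinearMap.fst ℝ ℂ V)) (c, z) := by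
          have h2 : HasFDerivAt (fun c : ℂ => ‖c‖ ^ 2) (2 • innerSL ℝ c) c :=
            (hasStrictFDerivAt_norm_sq c).hasFDerivAt
          have h3 := h2.sqrt (by positivity)
          simp only [Real.sqrt_sq (norm_nonneg _)] at h3
          have h4 := h3.comp (c, z) (hasFDerivAt_fst (𝕜 := ℝ) (E := ℂ) (F := V))
          refine h4.congr_fderiv (ContinuousLinearMap.ext fun q => ?_)
          simp
          ring
        have h5 := (hgd (‖c‖, z)).comp (c, z) (h1.prodMk hasFDerivAt_snd)
        refine h5.congr_fderiv (ContinuousLinearMap.ext fun q => ?_)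
        have hc' : ‖c‖ ≠ 0 := norm_ne_zero_iff.2 hc
        simp only [ContinuousLinearMap.comp_apply, ContinuousLinearMap.prod_apply]
        rw [hsplit, hg₁eq, smul_smul]
        simp [D, g₂]
        congr 1
        field_simp
    rw [Nat.cast_succ, contDiff_succ_iff_fderiv]
    refine ⟨fun p => (key p).differentiableAt, by simp, ?_⟩
    rw [show fderiv ℝ (fun p : ℂ × V => g (‖p.1‖, p.2)) = D from funext fun p => (key p).fderiv]
    refine ContDiff.add (ContDiff.smulRight ?_ (ih hg₁ hg₁even))
      ((ih hg₂ hg₂even).clm_comp contDiff_const)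
    exact ((innerSL ℝ).contDiff.comp contDiff_fst).clm_comp contDiff_const

/-- The primitive, vanishing at the origin, of the logarithmic derivative of `u` along rays. -/
noncomputable def rayLog {V : Type} [NormedAddCommGroup V] [NormedSpace ℝ V] (u : V → ℂ) (z : V) :
    ℂ :=
  ∫ t in (0 : ℝ)..1, fderiv ℝ u (t • z) z / u (t • z)

section rayLog

variable {V : Type} [NormedAddCommGroup V] [NormedSpace ℝ V] {u v : V → ℂ}

theorem rayLog_zero (u : V → ℂ) : rayLog u 0 = 0 := by
  simp [rayLog]

theorem contDiff_rayLog [FiniteDimensional ℝ V] (hu : ContDiff ℝ ∞ u) (h0 : ∀ z, u z ≠ 0) :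
    ContDiff ℝ ∞ (rayLog u) := by
  have hu' : ContDiff ℝ ∞ (fderiv ℝ u) := hu.fderiv_right (by simp)
  refine contDiff_infty_intervalIntegral_param
    (F := fun p : ℝ × V => fderiv ℝ u (p.1 • p.2) p.2 / u (p.1 • p.2)) ?_
  simp only [div_eq_mul_inv]
  exact ((hu'.comp (contDiff_fst.smul contDiff_snd)).clm_apply contDiff_snd).mul
    ((hu.comp (contDiff_fst.smul contDiff_snd)).inv fun p => h0 _)

theorem continuous_rayLog_integrand (hu : ContDiff ℝ ∞ u) (h0 : ∀ z, u z ≠ 0) (z : V) :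
    Continuous fun t : ℝ => fderiv ℝ u (t • z) z / u (t • z) := by
  have h1 : Continuous fun t : ℝ => fderiv ℝ u (t • z) :=
    (hu.continuous_fderiv (by simp)).comp (by fun_prop)
  exact (h1.clm_apply continuous_const).div (hu.continuous.comp (by fun_prop)) fun t => h0 _

theorem rayLog_mul (hu : ContDiff ℝ ∞ u) (hv : ContDiff ℝ ∞ v) (hu0 : ∀ z, u z ≠ 0)
    (hv0 : ∀ z, v z ≠ 0) (z : V) :
    rayLog (fun z => u z * v z) z = rayLog u z + rayLog v z := by
  rw [rayLog, rayLog, rayLog, ← intervalIntegral.integral_add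
    ((continuous_rayLog_integrand hu hu0 z).intervalIntegrable _ _)
    ((continuous_rayLog_integrand hv hv0 z).intervalIntegrable _ _)]
  congr 1
  ext t
  have h1 := hu0 (t • z)
  have h2 := hv0 (t • z)
  rw [fderiv_fun_mul (hu.differentiable (by simp) _) (hv.differentiable (by simp) _)]
  simp
  field_simp
  ring

theorem rayLog_comp (hu : ContDiff ℝ ∞ u) (A : V →L[ℝ] V) (z : V) :
    rayLog (fun z => u (A z)) z = rayLog u (A z) := by
  rw [rayLog, rayLog]
  congr 1
  ext t
  have h : HasFDerivAt (fun z => u (A z)) ((fderiv ℝ u (A (t • z))).comp A) (t • z) :=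
    HasFDerivAt.comp (g := u) _ (hu.differentiable (by simp) _).hasFDerivAt A.hasFDerivAt
  rw [h.fderiv]
  simp

theorem rayLog_of_fderiv_eq_zero (hu : ∀ z, fderiv ℝ u z = 0) (z : V) : rayLog u z = 0 := by
  simp [rayLog, hu]

theorem mul_exp_rayLog (hu : ContDiff ℝ ∞ u) (h0 : ∀ z, u z ≠ 0) (z : V) :
    u 0 * Complex.exp (rayLog u z) = u z := by
  let f : ℝ → ℂ := fun t => fderiv ℝ u (t • z) z / u (t • z)
  have hf : Continuous f := continuous_rayLog_integrand hu h0 z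
  have h1 : ∀ s, HasDerivAt (fun s => ∫ t in (0 : ℝ)..s, f t) (f s) s := fun s =>
    hf.integral_hasStrictDerivAt 0 s |>.hasDerivAt
  have h2 : ∀ s : ℝ, HasDerivAt (fun s : ℝ => u (s • z)) (fderiv ℝ u (s • z) z) s := fun s => by
    have := (hu.differentiable (by simp) (s • z)).hasFDerivAt.comp_hasDerivAt s
      ((hasDerivAt_id s).smul_const z)
    rw [one_smul] at this
    exact this
  have h3 : ∀ s : ℝ, HasDerivAt
      (fun s : ℝ => u (s • z) * Complex.exp (-∫ t in (0 : ℝ)..s, f t)) 0 s := fun s => by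
    have := (h2 s).mul (h1 s).neg.cexp
    refine this.congr_deriv ?_
    have := h0 (s • z)
    simp only [f]
    field_simp
    ring
  have h4 := is_const_of_deriv_eq_zero (fun s => (h3 s).differentiableAt)
    (fun s => (h3 s).deriv) 1 0
  simp only [one_smul, zero_smul, intervalIntegral.integral_same, neg_zero, Complex.exp_zero,
    mul_one] at h4
  rw [← h4, mul_assoc, ← Complex.exp_add]
  simp [rayLog, f]

end rayLog

/-- A complex number all of whose powers stay close to `1` is `1`. -/
theorem eq_one_of_forall_norm_pow_sub_one_le {r : ℂ} (h : ∀ k : ℕ, ‖r ^ k - 1‖ ≤ 1 / 2) :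
    r = 1 := by
  have key : ∀ m : ℕ, (3 / 2 : ℝ) ^ m * ‖r - 1‖ ≤ ‖r ^ 2 ^ m - 1‖ := fun m => by
    induction m with
    | zero => simp
    | succ m ih =>
      have h1 : r ^ 2 ^ (m + 1) - 1 = (r ^ 2 ^ m - 1) * (r ^ 2 ^ m + 1) := by ring
      have h2 : (3 / 2 : ℝ) ≤ ‖r ^ 2 ^ m + 1‖ := by
        have h3 : ‖(2 : ℂ)‖ ≤ ‖r ^ 2 ^ m + 1‖ + ‖r ^ 2 ^ m - 1‖ := by
          have h4 := norm_sub_le (r ^ 2 ^ m + 1) (r ^ 2 ^ m - 1)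
          rwa [show r ^ 2 ^ m + 1 - (r ^ 2 ^ m - 1) = 2 by ring] at h4
        have := h (2 ^ m)
        rw [Complex.norm_ofNat] at h3
        linarith
      rw [h1, norm_mul, pow_succ, mul_right_comm]
      exact mul_le_mul ih h2 (by norm_num) (norm_nonneg _)
  by_contra hr
  have hpos : 0 < ‖r - 1‖ := norm_pos_iff.2 (sub_ne_zero.2 hr)
  obtain ⟨m, hm⟩ := pow_unbounded_of_one_lt (1 / ‖r - 1‖) (by norm_num : (1 : ℝ) < 3 / 2)
  rw [div_lt_iff₀ hpos] at hm
  linarith [key m, h (2 ^ m)]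

/-- The three types of blocks of a nondegenerate fixed point. -/
inductive BlockKind
  | elliptic
  | hyperbolic
  | focus

namespace BlockKind

/-- The pairs `(ζ, η)` of complex numbers that occur as coordinates on a block. -/
def Compat : BlockKind → ℂ × ℂ → Prop
  | elliptic, p => p.2 = -(Complex.I / 2) * p.1
  | hyperbolic, p => p.1.im = 0 ∧ p.2.im = 0
  | focus, _ => True

/-- The complex numbers `c` for which `(ζ, η) ↦ (c ζ, η / conj c)` acts on a block. -/
def Adm : BlockKind → ℂ → Prop
  | elliptic, c => ‖c‖ = 1
  | hyperbolic, c => c.im = 0 ∧ c ≠ 0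
  | focus, c => c ≠ 0

/-- The Lie algebra of the group of admissible multipliers. -/
def Lie : BlockKind → ℂ → Prop
  | elliptic, s => s.re = 0
  | hyperbolic, s => s.im = 0
  | focus, _ => True

variable {k : BlockKind} {c d s : ℂ} {p : ℂ × ℂ}

theorem Adm.ne_zero (h : k.Adm c) : c ≠ 0 := by
  cases k
  · exact norm_ne_zero_iff.1 (by rw [show ‖c‖ = 1 from h]; exact one_ne_zero)
  · exact h.2
  · exact h

theorem Adm.mul (hc : k.Adm c) (hd : k.Adm d) : k.Adm (c * d) := by
  cases k
  · simp_all [Adm]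
  · simp_all [Adm]
  · simp_all [Adm]

theorem Adm.compat (hc : k.Adm c) (hp : k.Compat p) :
    k.Compat (c * p.1, (starRingEnd ℂ c)⁻¹ * p.2) := by
  cases k
  · have h1 : (starRingEnd ℂ c)⁻¹ = c := by
      rw [← Complex.inv_eq_conj hc, inv_inv]
    simp only [Compat] at hp ⊢
    rw [h1, hp]
    ring
  · obtain ⟨h1, h2⟩ := hp
    have h3 : starRingEnd ℂ c = c := Complex.conj_eq_iff_im.2 hc.1
    have h4 := hc.1
    simp only [Compat, h3]
    simp [h1, h2, h4]
  · trivial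

theorem Lie.adm_exp (h : k.Lie s) : k.Adm (Complex.exp s) := by
  cases k
  · simp only [Lie] at h
    simp [Adm, Complex.norm_exp, h]
  · simp only [Lie] at h
    refine ⟨?_, Complex.exp_ne_zero _⟩
    simp [Complex.exp_im, h]
  · exact Complex.exp_ne_zero _

theorem Lie.zero : k.Lie 0 := by
  cases k <;> simp [Lie]

theorem Lie.real_mul (hs : k.Lie s) (r : ℝ) : k.Lie (r * s) := by
  cases k <;> simp_all [Lie]

theorem Lie.sum {ι : Type*} {S : Finset ι} {f : ι → ℂ} (h : ∀ i ∈ S, k.Lie (f i)) :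
    k.Lie (∑ i ∈ S, f i) := by
  cases k
  · simpa [Lie, Complex.re_sum] using Finset.sum_eq_zero h
  · simpa [Lie, Complex.im_sum] using Finset.sum_eq_zero h
  · trivial

theorem Lie.compat (hs : k.Lie s) (hp : k.Compat p) :
    k.Compat (s * p.1, -starRingEnd ℂ s * p.2) := by
  cases k
  · have h1 : -starRingEnd ℂ s = s := by
      apply Complex.ext <;> simp_all [Lie]
    simp only [Compat] at hp ⊢
    rw [h1, hp]
    ring
  · simp only [Lie] at hs
    obtain ⟨h1, h2⟩ := hp
    simp [Compat, h1, h2, hs]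
  · trivial

end BlockKind

/-- Complex coordinates adapted to a model fixed point: a real vector space whose elements are
described by pairs `(ζ_b, η_b)` of complex numbers, one for every block `b`, such that
`Re ∑ (dζ̄_b ∧ dη_b)` is nondegenerate. -/
structure BlockModel (B V : Type) [Fintype B] [NormedAddCommGroup V] [NormedSpace ℝ V] where
  kind : B → BlockKind
  fst : B → V →L[ℝ] ℂ
  snd : B → V →L[ℝ] ℂ
  build : (B → ℂ × ℂ) →L[ℝ] V
  build_coords : ∀ z, build (fun b => (fst b z, snd b z)) = z
  compat : ∀ b z, (kind b).Compat (fst b z, snd b z)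
  coords_build : ∀ p, (∀ b, (kind b).Compat (p b)) → ∀ b, (fst b (build p), snd b (build p)) = p b
  nondeg : ∀ u, (∀ v, ∑ b, (starRingEnd ℂ (fst b u) * snd b v -
    starRingEnd ℂ (fst b v) * snd b u).re = 0) → u = 0

namespace BlockModel

variable {B V : Type} [Fintype B] [NormedAddCommGroup V] [NormedSpace ℝ V] (M : BlockModel B V)

/-- The symplectic form `Re ∑ (dζ̄_b ∧ dη_b)`. -/
noncomputable def form (u v : V) : ℝ :=
  ∑ b, (starRingEnd ℂ (M.fst b u) * M.snd b v - starRingEnd ℂ (M.fst b v) * M.snd b u).re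

/-- The complex first integral `ζ̄_b η_b`. -/
noncomputable def moment (b : B) (z : V) : ℂ :=
  starRingEnd ℂ (M.fst b z) * M.snd b z

/-- The polarization of `moment`. -/
noncomputable def polar (b : B) (z v : V) : ℂ :=
  starRingEnd ℂ (M.fst b v) * M.snd b z + starRingEnd ℂ (M.fst b z) * M.snd b v

/-- The block-diagonal action `(ζ_b, η_b) ↦ (c_b ζ_b, η_b / conj c_b)`. -/
noncomputable def act (c : B → ℂ) : V →L[ℝ] V :=
  M.build.comp (ContinuousLinearMap.pi fun b =>
    (c b • M.fst b).prod ((starRingEnd ℂ (c b))⁻¹ • M.snd b))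

/-- The infinitesimal generator of `act`. -/
noncomputable def gen (s : B → ℂ) : V →L[ℝ] V :=
  M.build.comp (ContinuousLinearMap.pi fun b =>
    (s b • M.fst b).prod ((-starRingEnd ℂ (s b)) • M.snd b))

open Classical in
/-- Replacement of the coordinates in the block `b`. -/
noncomputable def upd (b : B) (z : V) (p : ℂ × ℂ) : V :=
  M.build (Function.update (fun b => (M.fst b z, M.snd b z)) b p)

theorem ext {z w : V} (h1 : ∀ b, M.fst b z = M.fst b w) (h2 : ∀ b, M.snd b z = M.snd b w) :
    z = w := by
  rw [← M.build_coords z, ← M.build_coords w]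
  simp only [h1, h2]

variable {M}

section act

variable {c d s : B → ℂ}

theorem coords_act (hc : ∀ b, (M.kind b).Adm (c b)) (b : B) (z : V) :
    (M.fst b (M.act c z), M.snd b (M.act c z)) =
      (c b * M.fst b z, (starRingEnd ℂ (c b))⁻¹ * M.snd b z) :=
  M.coords_build (fun b => (c b * M.fst b z, (starRingEnd ℂ (c b))⁻¹ * M.snd b z))
    (fun b => (hc b).compat (M.compat b z)) b

theorem fst_act (hc : ∀ b, (M.kind b).Adm (c b)) (b : B) (z : V) :
    M.fst b (M.act c z) = c b * M.fst b z :=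
  congrArg Prod.fst (coords_act hc b z)

theorem snd_act (hc : ∀ b, (M.kind b).Adm (c b)) (b : B) (z : V) :
    M.snd b (M.act c z) = (starRingEnd ℂ (c b))⁻¹ * M.snd b z :=
  congrArg Prod.snd (coords_act hc b z)

theorem fst_gen (hs : ∀ b, (M.kind b).Lie (s b)) (b : B) (z : V) :
    M.fst b (M.gen s z) = s b * M.fst b z :=
  congrArg Prod.fst (M.coords_build (fun b => (s b * M.fst b z, -starRingEnd ℂ (s b) * M.snd b z))
    (fun b => (hs b).compat (M.compat b z)) b)

theorem snd_gen (hs : ∀ b, (M.kind b).Lie (s b)) (b : B) (z : V) :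
    M.snd b (M.gen s z) = -starRingEnd ℂ (s b) * M.snd b z :=
  congrArg Prod.snd (M.coords_build (fun b => (s b * M.fst b z, -starRingEnd ℂ (s b) * M.snd b z))
    (fun b => (hs b).compat (M.compat b z)) b)

theorem act_act (hc : ∀ b, (M.kind b).Adm (c b)) (hd : ∀ b, (M.kind b).Adm (d b)) (z : V) :
    M.act c (M.act d z) = M.act (fun b => c b * d b) z := by
  have hcd : ∀ b, (M.kind b).Adm (c b * d b) := fun b => (hc b).mul (hd b)
  refine M.ext (fun b => ?_) fun b => ?_
  · rw [fst_act hc, fst_act hd, fst_act hcd, mul_assoc]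
  · rw [snd_act hc, snd_act hd, snd_act hcd, map_mul, mul_inv, mul_assoc]

theorem act_one (z : V) : M.act (fun _ => 1) z = z := by
  simpa [act] using M.build_coords z

theorem form_gen (hs : ∀ b, (M.kind b).Lie (s b)) (z v : V) :
    M.form (M.gen s z) v = ∑ b, (starRingEnd ℂ (s b) * M.polar b z v).re := by
  refine Finset.sum_congr rfl fun b _ => congrArg Complex.re ?_
  rw [fst_gen hs, snd_gen hs, polar, map_mul]
  ring

theorem hasDerivAt_act_exp (hs : ∀ b, (M.kind b).Lie (s b)) (z : V) (t : ℝ) :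
    HasDerivAt (fun t : ℝ => M.act (fun b => Complex.exp (t * s b)) z)
      (M.gen s (M.act (fun b => Complex.exp (t * s b)) z)) t := by
  have hadm : ∀ b, (M.kind b).Adm (Complex.exp (t * s b)) := fun b => ((hs b).real_mul t).adm_exp
  have h1 : ∀ a c : ℂ, HasDerivAt (fun t : ℝ => Complex.exp (t * a) * c)
      (a * (Complex.exp (t * a) * c)) t := fun a c => by
    have h2 : HasDerivAt (fun t : ℝ => (t : ℂ) * a) a t := by
      simpa using (Complex.ofRealCLM.hasDerivAt (x := t)).mul_const a
    refine (h2.cexp.mul_const c).congr_deriv ?_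
    ring
  have h3 : ∀ (t : ℝ) (a : ℂ), (starRingEnd ℂ (Complex.exp (t * a)))⁻¹ =
      Complex.exp (t * -starRingEnd ℂ a) := fun t a => by
    rw [← Complex.exp_conj, ← Complex.exp_neg]
    simp
  have h4 : HasDerivAt (fun (t : ℝ) (b : B) => (Complex.exp (t * s b) * M.fst b z,
      Complex.exp (t * -starRingEnd ℂ (s b)) * M.snd b z))
      (fun b => (s b * (Complex.exp (t * s b) * M.fst b z),
        -starRingEnd ℂ (s b) * (Complex.exp (t * -starRingEnd ℂ (s b)) * M.snd b z))) t :=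
    hasDerivAt_pi.2 fun b => (h1 _ _).prodMk (h1 _ _)
  have h5 := M.build.hasFDerivAt.comp_hasDerivAt t h4
  have h6 : (fun t : ℝ => M.act (fun b => Complex.exp (t * s b)) z) =
      M.build ∘ fun (t : ℝ) (b : B) => (Complex.exp (t * s b) * M.fst b z,
        Complex.exp (t * -starRingEnd ℂ (s b)) * M.snd b z) := by
    ext t
    simp only [← h3]
    rfl
  rw [h6]
  refine h5.congr_deriv ?_
  simp only [← h3, ← fst_act hadm, ← snd_act hadm]
  rfl

end act

section equivariance

variable {φ : V → V}

theorem form_sub_left (u u' v : V) : M.form (u - u') v = M.form u v - M.form u' v := by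
  simp only [form, ← Finset.sum_sub_distrib]
  refine Finset.sum_congr rfl fun b _ => ?_
  rw [← Complex.sub_re]
  congr 1
  simp only [map_sub]
  ring

theorem fderiv_moment_comp (b : B) (z v : V) (hφ : DifferentiableAt ℝ φ z) :
    fderiv ℝ (fun z => M.moment b (φ z)) z v = M.polar b (φ z) (fderiv ℝ φ z v) := by
  have h1 : HasFDerivAt (fun z => starRingEnd ℂ (M.fst b (φ z)))
      ((Complex.conjCLE : ℂ →L[ℝ] ℂ).comp ((M.fst b).comp (fderiv ℝ φ z))) z :=
    (Complex.conjCLE : ℂ →L[ℝ] ℂ).hasFDerivAt.comp z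
      ((M.fst b).hasFDerivAt.comp z hφ.hasFDerivAt)
  have h2 : HasFDerivAt (fun z => M.snd b (φ z)) ((M.snd b).comp (fderiv ℝ φ z)) z :=
    (M.snd b).hasFDerivAt.comp z hφ.hasFDerivAt
  have h3 := (h1.mul h2).fderiv
  rw [show (fun z => M.moment b (φ z)) = (fun z => starRingEnd ℂ (M.fst b (φ z))) *
    fun z => M.snd b (φ z) from rfl, h3]
  simp [polar]
  ring

/-- A symplectic map preserving the moments commutes with the Hamiltonian flows. -/
theorem fst_comp_act_exp [FiniteDimensional ℝ V] (hφ : Differentiable ℝ φ)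
    (hsymp : ∀ z u v, M.form (fderiv ℝ φ z u) (fderiv ℝ φ z v) = M.form u v)
    (hmom : ∀ b z, M.moment b (φ z) = M.moment b z) {s : B → ℂ}
    (hs : ∀ b, (M.kind b).Lie (s b)) (b : B) (z : V) :
    M.fst b (φ (M.act (fun b => Complex.exp (s b)) z)) = Complex.exp (s b) * M.fst b (φ z) := by
  have hinj : ∀ z, Function.Injective (fderiv ℝ φ z) := fun z => by
    refine (injective_iff_map_eq_zero _).2 fun u hu => M.nondeg u fun v => ?_
    have := hsymp z u v
    rw [hu] at this
    rw [← form, ← this]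
    simp [form]
  have hsurj : ∀ z, Function.Surjective (fderiv ℝ φ z) := fun z =>
    LinearMap.surjective_of_injective (f := (fderiv ℝ φ z : V →ₗ[ℝ] V)) (hinj z)
  have hpolar : ∀ b z v, M.polar b (φ z) (fderiv ℝ φ z v) = M.polar b z v := fun b z v => by
    rw [← fderiv_moment_comp b z v (hφ z), show (fun z => M.moment b (φ z)) =
      fun z => M.moment b (id z) from funext (hmom b),
      fderiv_moment_comp b z v differentiableAt_id]
    simp
  have hgen : ∀ z, fderiv ℝ φ z (M.gen s z) = M.gen s (φ z) := fun z => by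
    rw [← sub_eq_zero]
    refine M.nondeg _ fun w => ?_
    obtain ⟨v, rfl⟩ := hsurj z w
    rw [← form, form_sub_left, hsymp, form_gen hs, form_gen hs]
    simp [hpolar]
  have hd : ∀ t : ℝ, HasDerivAt (fun t : ℝ => Complex.exp (t * -s b) *
      M.fst b (φ (M.act (fun b => Complex.exp (t * s b)) z))) 0 t := fun t => by
    have h1 : HasDerivAt (fun t : ℝ => (t : ℂ) * -s b) (-s b) t := by
      simpa using (Complex.ofRealCLM.hasDerivAt (x := t)).mul_const (-s b)
    have h2 := ((M.fst b).hasFDerivAt.comp _ (hφ _).hasFDerivAt).comp_hasDerivAt t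
      (hasDerivAt_act_exp hs z t)
    refine (h1.cexp.mul h2).congr_deriv ?_
    simp only [ContinuousLinearMap.comp_apply, hgen, fst_gen hs, Function.comp]
    ring
  have hconst := is_const_of_deriv_eq_zero (fun t => (hd t).differentiableAt)
    (fun t => (hd t).deriv) 1 0
  simp only [Complex.ofReal_one, one_mul, Complex.ofReal_zero, zero_mul, Complex.exp_zero,
    act_one] at hconst
  rw [← hconst, ← mul_assoc, ← Complex.exp_add]
  simp

end equivariance

end BlockModel

namespace BlockModel

variable {B V : Type} [Fintype B] [NormedAddCommGroup V] [NormedSpace ℝ V] {M : BlockModel B V}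

section upd

variable {b : B} {p : ℂ × ℂ}

open Classical in
theorem coords_upd (hp : (M.kind b).Compat p) (z : V) (b' : B) :
    (M.fst b' (M.upd b z p), M.snd b' (M.upd b z p)) =
      Function.update (fun b => (M.fst b z, M.snd b z)) b p b' := by
  refine M.coords_build _ (fun b' => ?_) b'
  rcases eq_or_ne b' b with rfl | h
  · simpa using hp
  · simpa [h] using M.compat b' z

theorem upd_self (z : V) : M.upd b z (M.fst b z, M.snd b z) = z := by
  classical
  rw [upd, Function.update_eq_self_iff.2 rfl, M.build_coords]

theorem fst_upd (hp : (M.kind b).Compat p) (z : V) : M.fst b (M.upd b z p) = p.1 := by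
  simpa using congrArg Prod.fst (coords_upd hp z b)

theorem act_upd {s : ℂ} (hs : (M.kind b).Lie s) (hp : (M.kind b).Compat p) (z : V) :
    ∃ s' : B → ℂ, (∀ b, (M.kind b).Lie (s' b)) ∧ s' b = s ∧
      M.act (fun b => Complex.exp (s' b)) (M.upd b z p) =
        M.upd b z (Complex.exp s * p.1, (starRingEnd ℂ (Complex.exp s))⁻¹ * p.2) := by
  classical
  have hs' : ∀ b', (M.kind b').Lie (Pi.single (M := fun _ => ℂ) b s b') := fun b' => by
    rcases eq_or_ne b' b with rfl | h
    · simpa using hs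
    · simpa [h] using BlockKind.Lie.zero
  have hadm := fun b => (hs' b).adm_exp
  have hp' := hs.adm_exp.compat hp
  have key : ∀ b', (M.fst b' (M.act (fun b' => Complex.exp (Pi.single (M := fun _ => ℂ) b s b'))
      (M.upd b z p)), M.snd b' (M.act (fun b' => Complex.exp (Pi.single (M := fun _ => ℂ) b s b'))
      (M.upd b z p))) =
      (M.fst b' (M.upd b z (Complex.exp s * p.1, (starRingEnd ℂ (Complex.exp s))⁻¹ * p.2)),
        M.snd b' (M.upd b z (Complex.exp s * p.1, (starRingEnd ℂ (Complex.exp s))⁻¹ * p.2))) :=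
    fun b' => by
      have h1 := coords_upd hp z b'
      rw [coords_act hadm, coords_upd hp']
      rcases eq_or_ne b' b with rfl | h
      · simp only [Function.update_self, Prod.ext_iff] at h1
        simp [h1.1, h1.2]
      · simp only [Function.update_of_ne h, Prod.ext_iff] at h1
        simp [h1.1, h1.2, h]
  exact ⟨_, hs', by simp, M.ext (fun b' => congrArg Prod.fst (key b'))
    fun b' => congrArg Prod.snd (key b')⟩

theorem contDiff_upd {E : Type} [NormedAddCommGroup E] [NormedSpace ℝ E] {f : E → V}
    {p : E → ℂ × ℂ} (hf : ContDiff ℝ ∞ f) (hp : ContDiff ℝ ∞ p) (b : B) :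
    ContDiff ℝ ∞ fun x => M.upd b (f x) (p x) := by
  classical
  refine M.build.contDiff.comp (contDiff_pi.2 fun b' => ?_)
  rcases eq_or_ne b' b with rfl | h
  · simpa using hp
  · simp only [Function.update_of_ne h]
    exact ((M.fst b').contDiff.comp hf).prodMk ((M.snd b').contDiff.comp hf)

theorem exists_fst_ne_zero (b : B) : ∃ z, M.fst b z ≠ 0 := by
  have h : ∃ p : ℂ × ℂ, (M.kind b).Compat p ∧ p.1 ≠ 0 := by
    cases M.kind b
    · exact ⟨(1, -(Complex.I / 2)), by simp [BlockKind.Compat], one_ne_zero⟩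
    · exact ⟨(1, 0), by simp [BlockKind.Compat], one_ne_zero⟩
    · exact ⟨(1, 0), trivial, one_ne_zero⟩
  obtain ⟨p, hp, hp1⟩ := h
  exact ⟨M.upd b 0 p, by rwa [fst_upd hp]⟩

theorem dense_fst_ne_zero (b : B) : Dense {z | M.fst b z ≠ 0} := by
  change Dense ((LinearMap.ker (M.fst b : V →ₗ[ℝ] ℂ) : Set V)ᶜ)
  rw [← interior_eq_empty_iff_dense_compl, ← Set.not_nonempty_iff_eq_empty]
  intro h
  have h1 := Submodule.eq_top_of_nonempty_interior' _ h
  obtain ⟨z, hz⟩ := M.exists_fst_ne_zero b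
  exact hz (LinearMap.mem_ker.1 (h1 ▸ Submodule.mem_top : z ∈ LinearMap.ker (M.fst b : V →ₗ[ℝ] ℂ)))

/-- Continuous functions that agree where `ζ_b ≠ 0` are equal. -/
theorem eq_of_eq_on_fst_ne_zero {X : Type} [TopologicalSpace X] [T2Space X] {f g : V → X}
    (b : B) (hf : Continuous f) (hg : Continuous g) (h : ∀ z, M.fst b z ≠ 0 → f z = g z) (z : V) :
    f z = g z :=
  congrFun (hf.ext_on (M.dense_fst_ne_zero b) hg h) z

end upd

/-- Maps whose `ζ`-components are equivariant under the Hamiltonian flows. -/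
def Equivariant (M : BlockModel B V) (φ : V → V) : Prop :=
  ∀ s : B → ℂ, (∀ b, (M.kind b).Lie (s b)) → ∀ b z,
    M.fst b (φ (M.act (fun b => Complex.exp (s b)) z)) = Complex.exp (s b) * M.fst b (φ z)

theorem Equivariant.fst_upd {φ : V → V} (hφ : M.Equivariant φ) {b : B} {p : ℂ × ℂ} {s : ℂ}
    (hs : (M.kind b).Lie s) (hp : (M.kind b).Compat p) (z : V) :
    M.fst b (φ (M.upd b z (Complex.exp s * p.1, (starRingEnd ℂ (Complex.exp s))⁻¹ * p.2))) =
      Complex.exp s * M.fst b (φ (M.upd b z p)) := by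
  obtain ⟨s', hs', rfl, h⟩ := act_upd hs hp z
  rw [← h, hφ s' hs']

/-- A smooth equivariant map multiplies every coordinate `ζ_b` by a smooth function. -/
theorem Equivariant.exists_multiplier [FiniteDimensional ℝ V] {φ : V → V} (hφ : M.Equivariant φ)
    (hsm : ContDiff ℝ ∞ φ) (b : B) :
    ∃ u : V → ℂ, ContDiff ℝ ∞ u ∧ ∀ z, M.fst b (φ z) = u z * M.fst b z := by
  suffices h : ∃ u : V → ℂ, ContDiff ℝ ∞ u ∧
      ∀ z, M.fst b z ≠ 0 → M.fst b (φ z) = u z * M.fst b z by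
    obtain ⟨u, hu, h⟩ := h
    exact ⟨u, hu, fun z => M.eq_of_eq_on_fst_ne_zero b
      (f := fun z => M.fst b (φ z)) (g := fun z => u z * M.fst b z)
      ((M.fst b).continuous.comp hsm.continuous)
      (hu.continuous.mul (M.fst b).continuous) h z⟩
  have hofReal : ContDiff ℝ ∞ (fun q : ℝ × V => (q.1 : ℂ)) :=
    Complex.ofRealCLM.contDiff.comp contDiff_fst
  cases hk : M.kind b with
  | elliptic =>
    let e : ℝ → ℂ × ℂ := fun x => (x, -(Complex.I / 2) * x)
    have he : ∀ x, (M.kind b).Compat (e x) := fun x => by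
      rw [hk]
      rfl
    have hrot : ∀ (a : ℝ), (M.kind b).Lie (a * Complex.I) := fun a => by
      simp [hk, BlockKind.Lie]
    let f : ℝ × V → ℂ := fun q => M.fst b (φ (M.upd b q.2 (e q.1)))
    have hf : ContDiff ℝ ∞ f := (M.fst b).contDiff.comp (hsm.comp
      (contDiff_upd contDiff_snd (hofReal.prodMk (contDiff_const.mul hofReal)) b))
    have hconj : ∀ a : ℝ, (starRingEnd ℂ (Complex.exp (a * Complex.I)))⁻¹ =
        Complex.exp (a * Complex.I) := fun a => by
      rw [← Complex.exp_conj, ← Complex.exp_neg]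
      simp
    have hodd : ∀ x z, f (-x, z) = -f (x, z) := fun x z => by
      have h := hφ.fst_upd (hrot Real.pi) (he x) z
      rw [hconj, Complex.exp_pi_mul_I] at h
      simpa [f, e] using h
    obtain ⟨g, hg, hfg⟩ := exists_contDiff_eq_smul hf fun z => by
      have := hodd 0 z
      rw [neg_zero] at this
      exact self_eq_neg.1 this
    have heven : ∀ x z, g (-x, z) = g (x, z) := fun x z => by
      rcases eq_or_ne x 0 with rfl | hx
      · simp
      · have h := hodd x z
        rw [hfg, hfg, neg_smul, neg_inj] at h
        exact smul_right_injective ℂ hx h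
    have hG : ContDiff ℝ ∞ fun q : ℂ × V => g (‖q.1‖, q.2) :=
      contDiff_infty.2 fun k => contDiff_comp_norm_of_even k hg heven
    refine ⟨fun z => g (‖M.fst b z‖, z), hG.comp ((M.fst b).contDiff.prodMk contDiff_id), ?_⟩
    intro z _
    have h := hφ.fst_upd (hrot (Complex.arg (M.fst b z))) (he ‖M.fst b z‖) z
    have h2 := M.compat b z
    rw [hk] at h2
    have h3 : (Complex.exp (Complex.arg (M.fst b z) * Complex.I) * (e ‖M.fst b z‖).1,
        Complex.exp (Complex.arg (M.fst b z) * Complex.I) * (e ‖M.fst b z‖).2) =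
        (M.fst b z, M.snd b z) := by
      have h4 := Complex.norm_mul_exp_arg_mul_I (M.fst b z)
      refine Prod.ext ?_ ?_
      · simp only [e]
        rw [mul_comm, h4]
      · simp only [e]
        rw [show M.snd b z = -(Complex.I / 2) * M.fst b z from h2]
        linear_combination (-(Complex.I / 2)) * h4
    rw [hconj, h3, upd_self] at h
    rw [h, show M.fst b (φ (M.upd b z (e ‖M.fst b z‖))) = _ from hfg ‖M.fst b z‖ z,
      Complex.real_smul, ← mul_assoc, mul_comm (Complex.exp _), Complex.norm_mul_exp_arg_mul_I,
      mul_comm]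
  | hyperbolic =>
    have hreal : ∀ z, M.fst b z = (M.fst b z).re ∧ (M.snd b z).im = 0 := fun z => by
      have h := M.compat b z
      rw [hk] at h
      exact ⟨Complex.ext (by simp) (by simpa using h.1), h.2⟩
    have he : ∀ (x : ℝ) z, (M.kind b).Compat (x, M.snd b z) := fun x z => by
      rw [hk]
      exact ⟨Complex.ofReal_im x, (hreal z).2⟩
    let f : ℝ × V → ℂ := fun q => M.fst b (φ (M.upd b q.2 (q.1, M.snd b q.2)))
    have hf : ContDiff ℝ ∞ f := (M.fst b).contDiff.comp (hsm.comp
      (contDiff_upd contDiff_snd (hofReal.prodMk ((M.snd b).contDiff.comp contDiff_snd)) b))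
    have hzero : ∀ z, f (0, z) = 0 := fun z => by
      let F : ℝ → ℂ := fun r => r * M.fst b (φ (M.upd b z (0, r * M.snd b z)))
      have hF : Continuous F := by
        have : ContDiff ℝ ∞ fun r : ℝ => M.upd b z (0, r * M.snd b z) :=
          contDiff_upd contDiff_const
            (contDiff_const.prodMk (Complex.ofRealCLM.contDiff.mul contDiff_const)) b
        exact Complex.continuous_ofReal.mul
          ((M.fst b).continuous.comp (hsm.continuous.comp this.continuous))
      have hFc : ∀ r : ℝ, 0 < r → F r = f (0, z) := fun r hr => by
        have hs : (M.kind b).Lie ((-Real.log r : ℝ) : ℂ) := by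
          simp [hk, BlockKind.Lie]
        have h := hφ.fst_upd hs (he 0 z) z
        rw [← Complex.ofReal_exp, Real.exp_neg, Real.exp_log hr, Complex.conj_ofReal] at h
        simp only [Complex.ofReal_zero, mul_zero, Complex.ofReal_inv, inv_inv] at h
        simp only [F, f, h, Complex.ofReal_zero]
        have : (r : ℂ) ≠ 0 := Complex.ofReal_ne_zero.2 hr.ne'
        field_simp
      have h1 : Filter.Tendsto F (nhdsWithin 0 (Ioi 0)) (nhds (F 0)) :=
        (hF.tendsto 0).mono_left nhdsWithin_le_nhds
      have h2 : Filter.Tendsto F (nhdsWithin 0 (Ioi 0)) (nhds (f (0, z))) :=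
        tendsto_const_nhds.congr' (Filter.eventuallyEq_of_mem self_mem_nhdsWithin
          fun r hr => (hFc r hr).symm)
      rw [tendsto_nhds_unique h2 h1]
      simp [F]
    obtain ⟨g, hg, hfg⟩ := exists_contDiff_eq_smul hf hzero
    refine ⟨fun z => g ((M.fst b z).re, z), hg.comp
      ((Complex.reCLM.contDiff.comp (M.fst b).contDiff).prodMk contDiff_id), fun z _ => ?_⟩
    have h := hfg (M.fst b z).re z
    simp only [f] at h
    rw [← (hreal z).1, upd_self, Complex.real_smul, ← (hreal z).1] at h
    rw [h, mul_comm]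
  | focus =>
    refine ⟨fun z => M.fst b (φ (M.upd b z (1, starRingEnd ℂ (M.fst b z) * M.snd b z))),
      (M.fst b).contDiff.comp (hsm.comp (contDiff_upd contDiff_id (contDiff_const.prodMk
        ((Complex.conjCLE.contDiff.comp (M.fst b).contDiff).mul (M.snd b).contDiff)) b)),
      fun z hz => ?_⟩
    have h := hφ.fst_upd (b := b) (p := (1, starRingEnd ℂ (M.fst b z) * M.snd b z))
      (s := Complex.log (M.fst b z)) (by rw [hk]; trivial) (by rw [hk]; trivial) z
    have hz' : starRingEnd ℂ (M.fst b z) ≠ 0 := (map_ne_zero _).2 hz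
    rw [Complex.exp_log hz, mul_one, inv_mul_cancel_left₀ hz', upd_self] at h
    rw [h, mul_comm]

end BlockModel

namespace BlockModel

variable {B V : Type} [Fintype B] [NormedAddCommGroup V] [NormedSpace ℝ V] {M : BlockModel B V}

/-- Actions of a topological group by smooth symplectic maps that fix the origin and preserve all
moments. -/
structure IsSymmetryAction (M : BlockModel B V) {G : Type*} [Group G] [TopologicalSpace G]
    (ρ : G → V → V) : Prop where
  continuous : Continuous fun gz : G × V => ρ gz.1 gz.2
  contDiff : ∀ g, ContDiff ℝ ∞ (ρ g)
  one : ∀ z, ρ 1 z = z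
  mul : ∀ g h z, ρ (g * h) z = ρ g (ρ h z)
  zero : ∀ g, ρ g 0 = 0
  symp : ∀ g z v w, M.form (fderiv ℝ (ρ g) z v) (fderiv ℝ (ρ g) z w) = M.form v w
  moment : ∀ g b z, M.moment b (ρ g z) = M.moment b z

/-- The action `ρ` multiplies the coordinate `ζ_b` by the smooth invariant function `u g b`. -/
structure IsMultiplier (M : BlockModel B V) {G : Type*} [Group G]
    (ρ : G → V → V) (u : G → B → V → ℂ) : Prop where
  contDiff : ∀ g b, ContDiff ℝ ∞ (u g b)
  adm : ∀ g b z, (M.kind b).Adm (u g b z)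
  eq_act : ∀ g z, ρ g z = M.act (fun b => u g b z) z
  act_exp : ∀ g b (s : B → ℂ), (∀ b, (M.kind b).Lie (s b)) → ∀ z,
    u g b (M.act (fun b => Complex.exp (s b)) z) = u g b z
  mul : ∀ g h b z, u (g * h) b z = u g b (ρ h z) * u h b z

variable {G : Type*} [Group G] [TopologicalSpace G] {ρ : G → V → V}

theorem IsSymmetryAction.exists_isMultiplier [FiniteDimensional ℝ V]
    (hρ : M.IsSymmetryAction ρ) : ∃ u, M.IsMultiplier ρ u := by
  have heq : ∀ g, M.Equivariant (ρ g) := fun g s hs b z =>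
    fst_comp_act_exp ((hρ.contDiff g).differentiable (by simp)) (hρ.symp g) (hρ.moment g) hs b z
  choose u hu huζ using fun g b => (heq g).exists_multiplier (hρ.contDiff g) b
  have hcu : ∀ g b, Continuous (u g b) := fun g b => (hu g b).continuous
  have hcρ : ∀ g, Continuous (ρ g) := fun g => (hρ.contDiff g).continuous
  have hmul : ∀ g h b z, u (g * h) b z = u g b (ρ h z) * u h b z := fun g h b z => by
    refine M.eq_of_eq_on_fst_ne_zero b (f := u (g * h) b)
      (g := fun z => u g b (ρ h z) * u h b z) (hcu _ _)
      (((hcu g b).comp (hcρ h)).mul (hcu h b)) (fun z hz => ?_) z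
    refine mul_right_cancel₀ hz ?_
    rw [← huζ, hρ.mul, huζ, huζ, mul_assoc]
  have hone : ∀ b z, u 1 b z = 1 := fun b z => by
    refine M.eq_of_eq_on_fst_ne_zero b (f := u 1 b) (g := fun _ => 1) (hcu _ _)
      continuous_const (fun z hz => ?_) z
    refine mul_right_cancel₀ hz ?_
    rw [← huζ, hρ.one, one_mul]
  have hne : ∀ g b z, u g b z ≠ 0 := fun g b z h => by
    have := hmul g⁻¹ g b z
    rw [inv_mul_cancel, hone, h, mul_zero] at this
    exact one_ne_zero this
  have hadm : ∀ g b z, (M.kind b).Adm (u g b z) := fun g b z => by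
    cases hk : M.kind b with
    | elliptic =>
      refine M.eq_of_eq_on_fst_ne_zero b (f := fun z => ‖u g b z‖) (g := fun _ => 1) (hcu g b).norm
        continuous_const (fun z hz => ?_) z
      have hη : ∀ z, M.snd b z = -(Complex.I / 2) * M.fst b z := fun z => by
        have := M.compat b z
        rwa [hk] at this
      have h := congrArg norm (hρ.moment g b z)
      simp only [BlockModel.moment, hη, huζ, norm_mul, RCLike.norm_conj] at h
      have h1 : 0 < ‖M.fst b z‖ := norm_pos_iff.2 hz
      have h2 : ‖-(Complex.I / 2)‖ ≠ 0 := by simp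
      have h3 : ‖u g b z‖ ^ 2 = 1 := by
        refine mul_right_cancel₀ (mul_ne_zero h2 (mul_pos h1 h1).ne') ?_
        linear_combination h
      nlinarith [norm_nonneg (u g b z)]
    | hyperbolic =>
      refine ⟨M.eq_of_eq_on_fst_ne_zero b (f := fun z => (u g b z).im) (g := fun _ => 0)
        (Complex.continuous_im.comp (hcu g b)) continuous_const (fun z hz => ?_) z, hne g b z⟩
      have hre : ∀ z, (M.fst b z).im = 0 := fun z => by
        have := M.compat b z
        rw [hk] at this
        exact this.1
      have h := hre (ρ g z)
      rw [huζ, Complex.mul_im, hre z, mul_zero, zero_add] at h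
      refine (mul_eq_zero.1 h).resolve_right fun h0 => hz (Complex.ext h0 (hre z))
    | focus => exact hne g b z
  refine ⟨u, hu, hadm, fun g z => ?_, fun g b s hs z => ?_, hmul⟩
  · refine M.ext (fun b => ?_) fun b => ?_
    · rw [fst_act fun b => hadm g b z, huζ]
    · rw [snd_act fun b => hadm g b z]
      refine M.eq_of_eq_on_fst_ne_zero b (f := fun z => M.snd b (ρ g z))
        (g := fun z => (starRingEnd ℂ (u g b z))⁻¹ * M.snd b z)
        ((M.snd b).continuous.comp (hcρ g))
        (((Complex.continuous_conj.comp (hcu g b)).inv₀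
          fun z => (map_ne_zero _).2 (hne g b z)).mul (M.snd b).continuous) (fun z hz => ?_) z
      have h := hρ.moment g b z
      have hz' : starRingEnd ℂ (M.fst b z) ≠ 0 := (map_ne_zero _).2 hz
      have hu' : starRingEnd ℂ (u g b z) ≠ 0 := (map_ne_zero _).2 (hne g b z)
      simp only [BlockModel.moment, huζ, map_mul] at h
      rw [eq_inv_mul_iff_mul_eq₀ hu']
      refine mul_left_cancel₀ hz' ?_
      linear_combination h
  · refine M.eq_of_eq_on_fst_ne_zero b
      (f := fun z => u g b (M.act (fun b => Complex.exp (s b)) z)) (g := u g b)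
      ((hcu g b).comp (M.act _).continuous) (hcu g b) (fun z hz => ?_) z
    have h := heq g s hs b z
    rw [huζ, huζ, fst_act fun b => (hs b).adm_exp] at h
    refine mul_right_cancel₀ (mul_ne_zero (Complex.exp_ne_zero (s b)) hz) ?_
    linear_combination h

end BlockModel

theorem BlockKind.Adm.exists_exp_eq {k : BlockKind} {c : ℂ} (hc : k.Adm c)
    (hpos : k = .hyperbolic → 0 < c.re) : ∃ s, k.Lie s ∧ Complex.exp s = c := by
  refine ⟨Complex.log c, ?_, Complex.exp_log hc.ne_zero⟩
  cases k
  · simp [Lie, Complex.log_re, show ‖c‖ = 1 from hc]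
  · have h : c = (c.re : ℂ) := Complex.ext rfl (by simpa using hc.1)
    have := hpos rfl
    rw [Lie, h, ← Complex.ofReal_log this.le, Complex.ofReal_im]
  · trivial

theorem rayLog_im_eq_zero {V : Type} [NormedAddCommGroup V] [NormedSpace ℝ V] {u : V → ℂ}
    (hu : Differentiable ℝ u) (him : ∀ z, (u z).im = 0) (z : V) : (rayLog u z).im = 0 := by
  have h1 : ∀ x v, (fderiv ℝ u x v).im = 0 := fun x v => by
    have h2 := (Complex.imCLM.hasFDerivAt.comp x (hu x).hasFDerivAt).fderiv
    rw [show Complex.imCLM ∘ u = fun _ => (0 : ℝ) from funext him] at h2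
    simpa using (congrArg (fun A => A v) h2).symm
  have h2 : rayLog u z = ∫ t in (0 : ℝ)..1, (((fderiv ℝ u (t • z) z / u (t • z)).re : ℝ) : ℂ) := by
    refine intervalIntegral.integral_congr fun t _ => Complex.ext rfl ?_
    simp [Complex.div_im, h1, him]
  rw [h2, intervalIntegral.integral_ofReal, Complex.ofReal_im]

namespace BlockModel

variable {B V : Type} [Fintype B] [NormedAddCommGroup V] [NormedSpace ℝ V] {M : BlockModel B V}

namespace IsMultiplier

variable {G : Type*} [Group G] {ρ : G → V → V} {u : G → B → V → ℂ} (hu : M.IsMultiplier ρ u)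
include hu

theorem ne_zero (g : G) (b : B) (z : V) : u g b z ≠ 0 :=
  (hu.adm g b z).ne_zero

theorem eq_mul_exp (g : G) (b : B) (z : V) :
    u g b z = u g b 0 * Complex.exp (rayLog (u g b) z) :=
  (mul_exp_rayLog (hu.contDiff g b) (hu.ne_zero g b) z).symm

theorem lie_rayLog (g : G) (b : B) (z : V) : (M.kind b).Lie (rayLog (u g b) z) := by
  have hadm := hu.adm g b
  cases hk : M.kind b with
  | elliptic =>
    simp only [hk, BlockKind.Adm] at hadm
    have h := congrArg norm (hu.eq_mul_exp g b z)
    rw [norm_mul, hadm, hadm, one_mul, Complex.norm_exp] at h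
    exact (Real.exp_eq_one_iff _).1 h.symm
  | hyperbolic =>
    simp only [hk, BlockKind.Adm] at hadm
    exact rayLog_im_eq_zero ((hu.contDiff g b).differentiable (by simp)) (fun z => (hadm z).1) z
  | focus => trivial

theorem rayLog_act_exp (g : G) (b : B) {s : B → ℂ} (hs : ∀ b, (M.kind b).Lie (s b)) (z : V) :
    rayLog (u g b) (M.act (fun b => Complex.exp (s b)) z) = rayLog (u g b) z := by
  rw [← rayLog_comp (hu.contDiff g b)]
  simp only [hu.act_exp g b s hs]

theorem apply_eq (g : G) (z : V) :
    ρ g z = M.act (fun b => Complex.exp (rayLog (u g b) z)) (M.act (fun b => u g b 0) z) := by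
  rw [hu.eq_act, act_act (fun b => (hu.lie_rayLog g b z).adm_exp) fun b => hu.adm g b 0]
  simp only [mul_comm (Complex.exp _), ← hu.eq_mul_exp]

theorem rayLog_mul (g h : G) (b : B) (z : V) :
    rayLog (u (g * h) b) z = rayLog (u g b) (M.act (fun b => u h b 0) z) + rayLog (u h b) z := by
  have h1 : u (g * h) b = fun z => u g b (M.act (fun b => u h b 0) z) * u h b z := by
    ext z
    rw [hu.mul, hu.apply_eq h, hu.act_exp g b _ fun b => hu.lie_rayLog h b z]
  rw [h1, _root_.rayLog_mul (u := fun z => u g b (M.act (fun b => u h b 0) z))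
    ((hu.contDiff g b).comp (M.act _).contDiff) (hu.contDiff h b)
    (fun z => hu.ne_zero g b _) (hu.ne_zero h b), rayLog_comp (hu.contDiff g b)]

theorem map_zero (g : G) : ρ g 0 = 0 := by
  rw [hu.eq_act, _root_.map_zero]

end IsMultiplier

end BlockModel

namespace BlockModel.IsMultiplier

variable {B V : Type} [Fintype B] [NormedAddCommGroup V] [NormedSpace ℝ V] {M : BlockModel B V}
  {G : Type*} [Group G] {ρ : G → V → V} {u : G → B → V → ℂ} (hu : M.IsMultiplier ρ u)
include hu

section exp

variable {g : G} {s : B → ℂ} (hs : ∀ b, (M.kind b).Lie (s b))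
  (hg : ∀ b, u g b 0 = Complex.exp (s b))
include hs hg

theorem mul_of_exp (g' : G) (b : B) (z : V) : u (g' * g) b z = u g' b z * u g b z := by
  rw [hu.mul, hu.apply_eq, hu.act_exp g' b _ fun b => hu.lie_rayLog g b z]
  simp only [hg, hu.act_exp g' b _ hs]

theorem pow_of_exp (k : ℕ) (b : B) (z : V) : u (g ^ k) b z = u g b z ^ k := by
  induction k with
  | zero =>
    have h := hu.mul_of_exp hs hg 1 b z
    rw [one_mul] at h
    rw [pow_zero, pow_zero]
    exact mul_right_cancel₀ (hu.ne_zero g b z) (by rw [one_mul, ← h])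
  | succ k ih => rw [pow_succ, hu.mul_of_exp hs hg, ih, pow_succ]

theorem inv_of_exp (b : B) (z : V) : u g⁻¹ b z = (u g b z)⁻¹ := by
  have h := hu.mul_of_exp hs hg g⁻¹ b z
  rw [inv_mul_cancel, ← pow_zero g, hu.pow_of_exp hs hg, pow_zero] at h
  exact eq_inv_of_mul_eq_one_left h.symm

variable [TopologicalSpace G] [CompactSpace G]

theorem eventually_eq_of_one_le_norm (hρ : Continuous fun gz : G × V => ρ gz.1 gz.2)
    (b : B) {z₀ : V} (hz₀ : M.fst b z₀ ≠ 0) (h1 : 1 ≤ ‖u g b z₀‖) :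
    ∀ᶠ z in nhds z₀, u g b z = u g b z₀ := by
  have hmult : ∀ g z, M.fst b z ≠ 0 → M.fst b (ρ g z) / M.fst b z = u g b z := fun g z hz => by
    rw [hu.eq_act, fst_act fun b => hu.adm g b z, mul_div_cancel_right₀ _ hz]
  have hc : ∀ z, M.fst b z ≠ 0 → ∀ g : G, ContinuousAt
      (fun p : V × G => M.fst b (ρ p.2 p.1) / M.fst b p.1) (z, g) := fun z hz g => by
    refine ContinuousAt.div ?_ ?_ hz
    · exact ((M.fst b).continuous.comp (hρ.comp continuous_swap)).continuousAt
    · exact ((M.fst b).continuous.comp continuous_fst).continuousAt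
  have hev : ∀ᶠ z in nhds z₀, ∀ g ∈ (univ : Set G), ‖M.fst b (ρ g z) / M.fst b z -
      M.fst b (ρ g z₀) / M.fst b z₀‖ < 1 / 2 := by
    refine isCompact_univ.eventually_forall_of_forall_eventually fun g _ => ?_
    have h2 : ContinuousAt (fun p : V × G => ‖M.fst b (ρ p.2 p.1) / M.fst b p.1 -
        M.fst b (ρ p.2 z₀) / M.fst b z₀‖) (z₀, g) := by
      refine ((hc z₀ hz₀ g).sub (ContinuousAt.div_const ?_ _)).norm
      exact ((M.fst b).continuous.comp
        (hρ.comp (continuous_snd.prodMk continuous_const))).continuousAt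
    refine h2.eventually_lt continuousAt_const ?_
    simp
  have hne : ∀ᶠ z in nhds z₀, M.fst b z ≠ 0 := (M.fst b).continuous.continuousAt.eventually_ne hz₀
  filter_upwards [hev, hne] with z hz hz'
  have h0 := hu.ne_zero g b z₀
  rw [← div_eq_one_iff_eq h0]
  refine eq_one_of_forall_norm_pow_sub_one_le fun k => ?_
  have h3 := hz (g ^ k) trivial
  rw [hmult _ _ hz', hmult _ _ hz₀, hu.pow_of_exp hs hg, hu.pow_of_exp hs hg] at h3
  rw [div_pow, div_sub_one (pow_ne_zero k h0), norm_div, norm_pow]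
  refine (div_le_self (norm_nonneg _) (one_le_pow₀ h1)).trans h3.le

theorem rayLog_eq_zero_of_exp (hρ : Continuous fun gz : G × V => ρ gz.1 gz.2) (b : B) (z : V) :
    rayLog (u g b) z = 0 := by
  refine rayLog_of_fderiv_eq_zero (fun z => ?_) z
  refine M.eq_of_eq_on_fst_ne_zero b (g := fun _ => 0)
    ((hu.contDiff g b).continuous_fderiv (by simp)) continuous_const (fun z₀ hz₀ => ?_) z
  suffices h : ∀ᶠ z in nhds z₀, u g b z = u g b z₀ by
    rw [Filter.EventuallyEq.fderiv_eq (f₁ := u g b) (f := fun _ => u g b z₀) h]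
    simp
  rcases le_total 1 ‖u g b z₀‖ with h1 | h1
  · exact hu.eventually_eq_of_one_le_norm hs hg hρ b hz₀ h1
  · have hs' : ∀ b, (M.kind b).Lie (-s b) := fun b => by
      simpa using (hs b).real_mul (-1)
    have hg' : ∀ b, u g⁻¹ b 0 = Complex.exp (-s b) := fun b => by
      rw [hu.inv_of_exp hs hg, hg, Complex.exp_neg]
    have h2 : 1 ≤ ‖u g⁻¹ b z₀‖ := by
      rw [hu.inv_of_exp hs hg, norm_inv]
      exact (one_le_inv₀ (norm_pos_iff.2 (hu.ne_zero g b z₀))).2 h1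
    filter_upwards [hu.eventually_eq_of_one_le_norm hs' hg' hρ b hz₀ h2] with z hz
    rwa [hu.inv_of_exp hs hg, hu.inv_of_exp hs hg, inv_inj] at hz

end exp

variable [TopologicalSpace G] [CompactSpace G]

theorem rayLog_eq_of_sign_eq (hρ : Continuous fun gz : G × V => ρ gz.1 gz.2) {g g' : G}
    (h : ∀ b, 0 < (u g b 0).re ↔ 0 < (u g' b 0).re) (b : B) (z : V) :
    rayLog (u g b) z = rayLog (u g' b) z := by
  have hq : ∀ b, u g b 0 = u g' b 0 * u (g'⁻¹ * g) b 0 := fun b => by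
    have := hu.mul g' (g'⁻¹ * g) b 0
    rwa [hu.map_zero, mul_inv_cancel_left] at this
  have hpos : ∀ b, M.kind b = .hyperbolic → 0 < (u (g'⁻¹ * g) b 0).re := fun b hb => by
    have hadm : ∀ g, (u g b 0).im = 0 ∧ (u g b 0).re ≠ 0 := fun g => by
      have := hu.adm g b 0
      rw [hb] at this
      exact ⟨this.1, fun h => this.2 (Complex.ext h this.1)⟩
    have h1 := congrArg Complex.re (hq b)
    rw [Complex.mul_re, (hadm g').1, zero_mul, sub_zero] at h1
    rcases (hadm g').2.lt_or_gt with h2 | h2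
    · have h3 : (u g b 0).re ≤ 0 := not_lt.1 fun h4 => absurd ((h b).1 h4) h2.not_gt
      have h4 := (hadm (g'⁻¹ * g)).2
      by_contra h5
      have h6 : (u (g'⁻¹ * g) b 0).re < 0 := lt_of_le_of_ne (not_lt.1 h5) h4
      nlinarith [mul_pos_of_neg_of_neg h2 h6]
    · have h3 := (h b).2 h2
      rw [h1] at h3
      exact (pos_iff_pos_of_mul_pos h3).1 h2
  choose s hs hexp using fun b => (hu.adm (g'⁻¹ * g) b 0).exists_exp_eq (hpos b)
  have h0 := hu.rayLog_eq_zero_of_exp hs (fun b => (hexp b).symm) hρ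
  rw [show g = g' * (g'⁻¹ * g) by group, hu.rayLog_mul, h0, add_zero]
  simp only [← hexp]
  exact hu.rayLog_act_exp g' b hs z

theorem finite_range_rayLog (hρ : Continuous fun gz : G × V => ρ gz.1 gz.2) :
    (range fun g b => rayLog (u g b)).Finite := by
  obtain ⟨e, he⟩ := (Function.factorsThrough_iff (f := fun g b => 0 < (u g b 0).re)
    fun g b => rayLog (u g b)).1 fun g g' h => funext fun b => funext fun z =>
      hu.rayLog_eq_of_sign_eq hρ (fun b => (congrFun h b).to_iff) b z
  rw [he]
  exact (finite_range e).subset (range_comp_subset_range _ _)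

end BlockModel.IsMultiplier

namespace BlockModel

variable {B V : Type} [Fintype B] [NormedAddCommGroup V] [NormedSpace ℝ V] {M : BlockModel B V}

/-- The map `z ↦ act (exp (τ z)) z` is symplectic if and only if this bilinear form vanishes. -/
noncomputable def defect (M : BlockModel B V) (τ : B → V → ℂ) (z v w : V) : ℝ :=
  ∑ b, (starRingEnd ℂ (fderiv ℝ (τ b) z v) * M.polar b z w -
    starRingEnd ℂ (fderiv ℝ (τ b) z w) * M.polar b z v).re

theorem contDiff_act {m : B → V → ℂ} (hm : ∀ b, ContDiff ℝ ∞ (m b)) (h0 : ∀ b z, m b z ≠ 0) :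
    ContDiff ℝ ∞ fun z => M.act (fun b => m b z) z := by
  refine M.build.contDiff.comp (contDiff_pi.2 fun b => ContDiff.prodMk ?_ ?_)
  · exact (hm b).mul (M.fst b).contDiff
  · exact ((Complex.conjCLE.contDiff.comp (hm b)).inv
      fun z => (map_ne_zero (starRingEnd ℂ)).2 (h0 b z)).mul (M.snd b).contDiff

section multiplier

variable {φ : V → V} {c : B → ℂ} {τ : B → V → ℂ} (hφ : Differentiable ℝ φ)
  (hτ : ∀ b, Differentiable ℝ (τ b)) (hc : ∀ b, (M.kind b).Adm (c b))
  (hlie : ∀ b z, (M.kind b).Lie (τ b z))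
  (heq : ∀ z, φ z = M.act (fun b => c b * Complex.exp (τ b z)) z)
include hφ hτ hc hlie heq

theorem fst_fderiv_of_eq_act (b : B) (z v : V) : M.fst b (fderiv ℝ φ z v) =
    c b * Complex.exp (τ b z) * (fderiv ℝ (τ b) z v * M.fst b z + M.fst b v) := by
  have h1 : HasFDerivAt (fun z => M.fst b (φ z)) ((M.fst b).comp (fderiv ℝ φ z)) z :=
    (M.fst b).hasFDerivAt.comp z (hφ z).hasFDerivAt
  have h2 := (((hτ b z).hasFDerivAt.cexp.const_mul (c b)).mul
    (M.fst b).hasFDerivAt).congr_of_eventuallyEq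
    (f₁ := fun z => M.fst b (φ z)) (Filter.Eventually.of_forall fun z => by
      simp only [heq, fst_act fun b => (hc b).mul (hlie b z).adm_exp, Pi.mul_apply])
  have h3 := congrArg (fun A : V →L[ℝ] ℂ => A v) (h1.unique h2)
  simp only [ContinuousLinearMap.comp_apply, add_apply,
    smul_apply, smul_eq_mul] at h3
  rw [h3]
  ring

theorem snd_fderiv_of_eq_act (b : B) (z v : V) : M.snd b (fderiv ℝ φ z v) =
    (starRingEnd ℂ (c b * Complex.exp (τ b z)))⁻¹ *
      (M.snd b v - starRingEnd ℂ (fderiv ℝ (τ b) z v) * M.snd b z) := by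
  have h0 : ∀ z, (starRingEnd ℂ (c b * Complex.exp (τ b z)))⁻¹ =
      (starRingEnd ℂ (c b))⁻¹ * Complex.exp (-starRingEnd ℂ (τ b z)) := fun z => by
    rw [map_mul, mul_inv, ← Complex.exp_conj, ← Complex.exp_neg]
  have h1 : HasFDerivAt (fun z => M.snd b (φ z)) ((M.snd b).comp (fderiv ℝ φ z)) z :=
    (M.snd b).hasFDerivAt.comp z (hφ z).hasFDerivAt
  have hconj : HasFDerivAt (fun z => starRingEnd ℂ (τ b z))
      ((Complex.conjCLE : ℂ →L[ℝ] ℂ).comp (fderiv ℝ (τ b) z)) z :=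
    (Complex.conjCLE : ℂ →L[ℝ] ℂ).hasFDerivAt.comp z (hτ b z).hasFDerivAt
  have h2 := ((hconj.neg.cexp.const_mul (starRingEnd ℂ (c b))⁻¹).mul
    (M.snd b).hasFDerivAt).congr_of_eventuallyEq
    (f₁ := fun z => M.snd b (φ z)) (Filter.Eventually.of_forall fun z => by
      simp only [heq, snd_act fun b => (hc b).mul (hlie b z).adm_exp, Pi.mul_apply, h0,
        Pi.neg_apply])
  have h3 := congrArg (fun A : V →L[ℝ] ℂ => A v) (h1.unique h2)
  simp only [ContinuousLinearMap.comp_apply, add_apply,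
    smul_apply, smul_eq_mul, neg_apply,
    ContinuousLinearEquiv.coe_coe, Complex.conjCLE_apply, Pi.neg_apply] at h3
  rw [h3, h0]
  ring

theorem form_fderiv_of_eq_act (z v w : V) :
    M.form (fderiv ℝ φ z v) (fderiv ℝ φ z w) = M.form v w + M.defect τ z v w := by
  rw [form, form, defect, ← Finset.sum_add_distrib]
  refine Finset.sum_congr rfl fun b _ => ?_
  rw [← Complex.add_re]
  congr 1
  have hm : starRingEnd ℂ (c b * Complex.exp (τ b z)) ≠ 0 :=
    (map_ne_zero _).2 ((hc b).mul (hlie b z).adm_exp).ne_zero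
  simp only [fst_fderiv_of_eq_act hφ hτ hc hlie heq, snd_fderiv_of_eq_act hφ hτ hc hlie heq, polar,
    map_mul (starRingEnd ℂ) (c b * Complex.exp (τ b z)), map_add,
    map_mul (starRingEnd ℂ) (fderiv ℝ _ _ _)]
  field_simp
  ring

end multiplier

section average

variable {G : Type*} [Group G] {ρ : G → V → V} {u : G → B → V → ℂ}

theorem IsMultiplier.eq_act_mul_exp (hu : M.IsMultiplier ρ u) (g : G) (z : V) :
    ρ g z = M.act (fun b => u g b 0 * Complex.exp (rayLog (u g b) z)) z := by
  simp only [hu.eq_act g z, ← hu.eq_mul_exp]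

theorem IsMultiplier.fderiv_zero [FiniteDimensional ℝ V] (hu : M.IsMultiplier ρ u) {g : G}
    (hg : ContDiff ℝ ∞ (ρ g)) :
    fderiv ℝ (ρ g) 0 = M.act fun b => u g b 0 := by
  have hφ : Differentiable ℝ (ρ g) := hg.differentiable (by simp)
  have hτ : ∀ b, Differentiable ℝ (rayLog (u g b)) := fun b =>
    (contDiff_rayLog (hu.contDiff g b) (hu.ne_zero g b)).differentiable (by simp)
  have hc := fun b => hu.adm g b 0
  ext1 v
  refine M.ext (fun b => ?_) fun b => ?_
  · rw [fst_act hc, fst_fderiv_of_eq_act hφ hτ hc (hu.lie_rayLog g) (hu.eq_act_mul_exp g)]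
    simp [rayLog_zero]
  · rw [snd_act hc, snd_fderiv_of_eq_act hφ hτ hc (hu.lie_rayLog g) (hu.eq_act_mul_exp g)]
    simp [rayLog_zero]

theorem IsMultiplier.defect_rayLog [FiniteDimensional ℝ V] (hu : M.IsMultiplier ρ u) {g : G}
    (hg : ContDiff ℝ ∞ (ρ g))
    (hsymp : ∀ z v w, M.form (fderiv ℝ (ρ g) z v) (fderiv ℝ (ρ g) z w) = M.form v w) (z v w : V) :
    M.defect (fun b => rayLog (u g b)) z v w = 0 := by
  have h := form_fderiv_of_eq_act (hg.differentiable (by simp)) (fun b =>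
    (contDiff_rayLog (hu.contDiff g b) (hu.ne_zero g b)).differentiable (by simp))
    (fun b => hu.adm g b 0) (hu.lie_rayLog g) (hu.eq_act_mul_exp g) z v w
  rw [hsymp] at h
  linarith

theorem defect_sum {ι : Type*} (F : Finset ι) (r : ℝ) {τ : ι → B → V → ℂ}
    (hτ : ∀ i ∈ F, ∀ b, Differentiable ℝ (τ i b)) (z v w : V) :
    M.defect (fun b z => r * ∑ i ∈ F, τ i b z) z v w = r * ∑ i ∈ F, M.defect (τ i) z v w := by
  have h : ∀ b v, fderiv ℝ (fun z => (r : ℂ) * ∑ i ∈ F, τ i b z) z v =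
      r * ∑ i ∈ F, fderiv ℝ (τ i b) z v := fun b v => by
    rw [((HasFDerivAt.fun_sum fun i hi => (hτ i hi b z).hasFDerivAt).const_mul (r : ℂ)).fderiv]
    simp
  simp only [defect, h]
  rw [Finset.sum_comm, Finset.mul_sum]
  refine Finset.sum_congr rfl fun b _ => ?_
  rw [← Complex.re_sum, ← Complex.re_ofReal_mul]
  simp only [map_mul, map_sum, Complex.conj_ofReal, Finset.sum_sub_distrib, ← Finset.sum_mul]
  congr 1
  ring

variable [TopologicalSpace G] [CompactSpace G]

theorem IsMultiplier.exists_average [FiniteDimensional ℝ V] (hρ : M.IsSymmetryAction ρ)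
    (hu : M.IsMultiplier ρ u) : ∃ S : B → V → ℂ, (∀ b, ContDiff ℝ ∞ (S b)) ∧
      (∀ b z, (M.kind b).Lie (S b z)) ∧
      (∀ b (s : B → ℂ), (∀ b, (M.kind b).Lie (s b)) → ∀ z,
        S b (M.act (fun b => Complex.exp (s b)) z) = S b z) ∧
      (∀ g b z, S b (M.act (fun b => u g b 0) z) = S b z - rayLog (u g b) z) ∧
      ∀ z v w, M.defect S z v w = 0 := by
  have hfin := hu.finite_range_rayLog hρ.continuous
  obtain ⟨F, hF⟩ : ∃ F : Finset (B → V → ℂ), ∀ f, f ∈ F ↔ ∃ g, f = fun b => rayLog (u g b) :=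
    ⟨hfin.toFinset, fun f => by simp [eq_comm]⟩
  have hcard : ((F.card : ℝ) : ℂ) ≠ 0 := by
    have : F.Nonempty := ⟨_, (hF _).2 ⟨1, rfl⟩⟩
    simpa using this.ne_empty
  have hsm : ∀ f ∈ F, ∀ b, ContDiff ℝ ∞ (f b) := fun f hf b => by
    obtain ⟨g, rfl⟩ := (hF f).1 hf
    exact contDiff_rayLog (hu.contDiff g b) (hu.ne_zero g b)
  refine ⟨fun b z => ((F.card : ℝ)⁻¹ : ℝ) * ∑ f ∈ F, f b z, fun b => ?_, fun b z => ?_,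
    fun b s hs z => ?_, fun h b z => ?_, fun z v w => ?_⟩
  · exact contDiff_const.mul (ContDiff.sum fun f hf => hsm f hf b)
  · have h : (M.kind b).Lie (∑ f ∈ F, f b z) := BlockKind.Lie.sum fun f hf => by
      obtain ⟨g, rfl⟩ := (hF f).1 hf
      exact hu.lie_rayLog g b z
    exact h.real_mul _
  · refine congrArg ((((F.card : ℝ)⁻¹ : ℝ) : ℂ) * ·) (Finset.sum_congr rfl fun f hf => ?_)
    obtain ⟨g, rfl⟩ := (hF f).1 hf
    exact hu.rayLog_act_exp g b hs z
  · let P : G → (B → V → ℂ) → B → V → ℂ := fun h f b z =>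
      f b (M.act (fun b => u h b 0) z) + rayLog (u h b) z
    have hP : ∀ g h, P h (fun b => rayLog (u g b)) = fun b => rayLog (u (g * h) b) := fun g h => by
      ext b z
      exact (hu.rayLog_mul g h b z).symm
    have hsum : ∑ f ∈ F, P h f b z = ∑ f ∈ F, f b z := by
      refine Finset.sum_nbij' (P h) (P h⁻¹) ?_ ?_ ?_ ?_ fun f _ => rfl
      · intro f hf
        obtain ⟨g, rfl⟩ := (hF f).1 hf
        exact (hF _).2 ⟨g * h, hP g h⟩
      · intro f hf
        obtain ⟨g, rfl⟩ := (hF f).1 hf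
        exact (hF _).2 ⟨g * h⁻¹, hP g h⁻¹⟩
      · intro f hf
        obtain ⟨g, rfl⟩ := (hF f).1 hf
        rw [hP, hP, mul_inv_cancel_right]
      · intro f hf
        obtain ⟨g, rfl⟩ := (hF f).1 hf
        rw [hP, hP, inv_mul_cancel_right]
    simp only [P, Finset.sum_add_distrib, Finset.sum_const, nsmul_eq_mul] at hsum
    push_cast at hcard ⊢
    rw [← hsum]
    field_simp
    ring
  · rw [defect_sum (τ := fun f => f) F _ fun f hf b => (hsm f hf b).differentiable (by simp)]
    refine mul_eq_zero_of_right _ (Finset.sum_eq_zero fun f hf => ?_)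
    obtain ⟨g, rfl⟩ := (hF f).1 hf
    exact hu.defect_rayLog (hρ.contDiff g) (hρ.symp g) z v w

/-- Linearization of compact symmetry groups of a model fixed point. -/
theorem IsSymmetryAction.exists_linearization [FiniteDimensional ℝ V]
    (hρ : M.IsSymmetryAction ρ) : ∃ Φ : V → V, Φ 0 = 0 ∧ ContDiff ℝ ∞ Φ ∧ Function.Injective Φ ∧
      (∀ z v w, M.form (fderiv ℝ Φ z v) (fderiv ℝ Φ z w) = M.form v w) ∧
      (∀ b z, M.moment b (Φ z) = M.moment b z) ∧
      ∀ g z, Φ (ρ g z) = fderiv ℝ (ρ g) 0 (Φ z) := by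
  obtain ⟨u, hu⟩ := hρ.exists_isMultiplier
  obtain ⟨S, hsm, hlie, hinv, hS, hdef⟩ := hu.exists_average hρ
  have hadm : ∀ z b, (M.kind b).Adm (Complex.exp (S b z)) := fun z b => (hlie b z).adm_exp
  have hΦ : ContDiff ℝ ∞ fun z => M.act (fun b => Complex.exp (S b z)) z :=
    contDiff_act (fun b => (hsm b).cexp) fun b z => Complex.exp_ne_zero _
  refine ⟨fun z => M.act (fun b => Complex.exp (S b z)) z, map_zero _, hΦ, fun z w h => ?_,
    fun z v w => ?_, fun b z => ?_, fun g z => ?_⟩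
  · have h1 : ∀ b, S b z = S b w := fun b => by
      rw [← hinv b _ (fun b => hlie b z) z, ← hinv b _ (fun b => hlie b w) w]
      exact congrArg (S b) h
    refine M.ext (fun b => ?_) fun b => ?_
    · have h2 := congrArg (M.fst b) h
      simp only [fst_act (hadm _), h1] at h2
      exact mul_left_cancel₀ (Complex.exp_ne_zero _) h2
    · have h2 := congrArg (M.snd b) h
      simp only [snd_act (hadm _), h1] at h2
      exact mul_left_cancel₀ (inv_ne_zero ((map_ne_zero _).2 (Complex.exp_ne_zero _))) h2
  · rw [form_fderiv_of_eq_act (c := fun _ => 1) (τ := S) (hΦ.differentiable (by simp))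
      (fun b => (hsm b).differentiable (by simp))
      (fun b => by simpa using (BlockKind.Lie.zero (k := M.kind b)).adm_exp) hlie
      (fun z => by simp only [one_mul]), hdef, add_zero]
  · simp only [BlockModel.moment]
    rw [fst_act (hadm z), snd_act (hadm z), map_mul]
    have : starRingEnd ℂ (Complex.exp (S b z)) ≠ 0 := (map_ne_zero _).2 (Complex.exp_ne_zero _)
    field_simp
  · have h1 : ∀ b, S b (ρ g z) = S b z - rayLog (u g b) z := fun b => by
      rw [hu.apply_eq, hinv b _ fun b => hu.lie_rayLog g b z, hS]
    have h2 : M.act (fun b => Complex.exp (S b (ρ g z))) (ρ g z) =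
        M.act (fun b => Complex.exp (S b (ρ g z))) (M.act (fun b => u g b z) z) :=
      congrArg _ (hu.eq_act g z)
    simp only
    rw [h2, hu.fderiv_zero (hρ.contDiff g), act_act (fun b => hu.adm g b 0) (hadm z),
      act_act (hadm _) fun b => hu.adm g b z]
    refine congrArg (fun c => M.act c z) (funext fun b => ?_)
    rw [h1, hu.eq_mul_exp g b z, mul_left_comm, ← Complex.exp_add, sub_add_cancel]

end average

end BlockModel

section williamson

variable {ke kh n : ℕ} {i j : Fin n} (z : Fin n → ℝ × ℝ)

theorem williamson_of_lt (h : i.val < ke) :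
    williamson ke kh i z = (z i).1 ^ 2 + (z i).2 ^ 2 := by
  simp [williamson, h]

theorem williamson_of_le_of_lt (h1 : ke ≤ i.val) (h2 : i.val < ke + kh) :
    williamson ke kh i z = (z i).1 * (z i).2 := by
  simp [williamson, h1.not_gt, h2]

theorem williamson_of_even (h1 : ke + kh ≤ i.val) (h2 : (i.val - (ke + kh)) % 2 = 0)
    (hj : j.val = i.val + 1) :
    williamson ke kh i z = (z i).1 * (z j).2 - (z j).1 * (z i).2 := by
  have h3 : ¬ i.val < ke := by omega
  simp [williamson, h3, h1.not_gt, h2, ← hj]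

theorem williamson_of_odd (h1 : ke + kh ≤ i.val) (h2 : (i.val - (ke + kh)) % 2 = 0)
    (hj : j.val = i.val + 1) :
    williamson ke kh j z = (z i).1 * (z i).2 + (z j).1 * (z j).2 := by
  have h3 : ¬ j.val < ke := by omega
  have h4 : ¬ j.val < ke + kh := by omega
  have h5 : (j.val - (ke + kh)) % 2 ≠ 0 := by omega
  have h6 : j.val - 1 = i.val := by omega
  simp [williamson, h3, h4, h5, h6]

end williamson

section model

/-- The blocks of a fixed point of Williamson type `(ke, kh, kf)`. -/
abbrev WilliamsonBlock (ke kh kf : ℕ) : Type := Fin ke ⊕ Fin kh ⊕ Fin kf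

/-- The degrees of freedom of a fixed point of Williamson type `(ke, kh, kf)`. -/
abbrev WilliamsonIndex (ke kh kf : ℕ) : Type := Fin ke ⊕ Fin kh ⊕ Fin kf × Fin 2

variable {ke kh kf n : ℕ}

/-- The enumeration of the degrees of freedom used by `williamson`. -/
def WilliamsonIndex.toFin (hn : n = ke + kh + 2 * kf) : WilliamsonIndex ke kh kf → Fin n
  | .inl a => ⟨a, by omega⟩
  | .inr (.inl a) => ⟨ke + a, by omega⟩
  | .inr (.inr a) => ⟨ke + kh + 2 * a.1 + a.2, by omega⟩

theorem WilliamsonIndex.toFin_bijective (hn : n = ke + kh + 2 * kf) :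
    Function.Bijective (toFin hn) := by
  rw [Fintype.bijective_iff_injective_and_card]
  refine ⟨fun p q h => ?_, by simp; omega⟩
  rcases p with p | p | ⟨p, r⟩ <;> rcases q with q | q | ⟨q, t⟩ <;>
    simp only [toFin, Fin.mk.injEq, Sum.inl.injEq, Sum.inr.injEq, Prod.mk.injEq,
      reduceCtorEq] at h ⊢ <;>
    omega

/-- The enumeration of the degrees of freedom as an equivalence. -/
noncomputable def WilliamsonIndex.equivFin (hn : n = ke + kh + 2 * kf) :
    WilliamsonIndex ke kh kf ≃ Fin n :=
  Equiv.ofBijective _ (toFin_bijective hn)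

/-- The complex-valued map with prescribed real and imaginary parts. -/
noncomputable def complexOfParts {E : Type} [NormedAddCommGroup E] [NormedSpace ℝ E]
    (p q : E →L[ℝ] ℝ) : E →L[ℝ] ℂ :=
  (Complex.equivRealProdCLM.symm : ℝ × ℝ →L[ℝ] ℂ).comp (p.prod q)

@[simp]
theorem complexOfParts_apply {E : Type} [NormedAddCommGroup E] [NormedSpace ℝ E]
    (p q : E →L[ℝ] ℝ) (z : E) : complexOfParts p q z = ⟨p z, q z⟩ := by
  apply Complex.ext <;> simp [complexOfParts]

/-- The position coordinate with index `i`. -/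
noncomputable def posCoord (i : Fin n) : (Fin n → ℝ × ℝ) →L[ℝ] ℝ :=
  (ContinuousLinearMap.fst ℝ ℝ ℝ).comp (ContinuousLinearMap.proj i)

/-- The momentum coordinate with index `i`. -/
noncomputable def momCoord (i : Fin n) : (Fin n → ℝ × ℝ) →L[ℝ] ℝ :=
  (ContinuousLinearMap.snd ℝ ℝ ℝ).comp (ContinuousLinearMap.proj i)

@[simp]
theorem posCoord_apply (i : Fin n) (z : Fin n → ℝ × ℝ) : posCoord i z = (z i).1 := rfl

@[simp]
theorem momCoord_apply (i : Fin n) (z : Fin n → ℝ × ℝ) : momCoord i z = (z i).2 := rfl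

namespace WilliamsonIndex

variable (e : WilliamsonIndex ke kh kf ≃ Fin n)

/-- The type of a block. -/
def kind : WilliamsonBlock ke kh kf → BlockKind
  | .inl _ => .elliptic
  | .inr (.inl _) => .hyperbolic
  | .inr (.inr _) => .focus

/-- The first complex coordinate on a block. -/
noncomputable def fst : WilliamsonBlock ke kh kf → (Fin n → ℝ × ℝ) →L[ℝ] ℂ
  | .inl a => complexOfParts (posCoord (e (.inl a))) (momCoord (e (.inl a)))
  | .inr (.inl a) => complexOfParts (posCoord (e (.inr (.inl a)))) 0
  | .inr (.inr a) => complexOfParts (posCoord (e (.inr (.inr (a, 0)))))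
      (posCoord (e (.inr (.inr (a, 1)))))

/-- The second complex coordinate on a block. -/
noncomputable def snd : WilliamsonBlock ke kh kf → (Fin n → ℝ × ℝ) →L[ℝ] ℂ
  | .inl a => (-(Complex.I / 2)) •
      complexOfParts (posCoord (e (.inl a))) (momCoord (e (.inl a)))
  | .inr (.inl a) => complexOfParts (momCoord (e (.inr (.inl a)))) 0
  | .inr (.inr a) => complexOfParts (momCoord (e (.inr (.inr (a, 0)))))
      (momCoord (e (.inr (.inr (a, 1)))))

/-- The position and momentum coordinates in terms of the complex ones. -/
def realCoords (p : WilliamsonBlock ke kh kf → ℂ × ℂ) : WilliamsonIndex ke kh kf → ℝ × ℝ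
  | .inl a => ((p (.inl a)).1.re, (p (.inl a)).1.im)
  | .inr (.inl a) => ((p (.inr (.inl a))).1.re, (p (.inr (.inl a))).2.re)
  | .inr (.inr a) => if a.2 = 0 then ((p (.inr (.inr a.1))).1.re, (p (.inr (.inr a.1))).2.re)
      else ((p (.inr (.inr a.1))).1.im, (p (.inr (.inr a.1))).2.im)

/-- The point with given complex coordinates. -/
noncomputable def build : (WilliamsonBlock ke kh kf → ℂ × ℂ) →L[ℝ] Fin n → ℝ × ℝ :=
  LinearMap.toContinuousLinearMap
    { toFun := fun p i => realCoords p (e.symm i)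
      map_add' := fun p q => by
        ext i <;> simp only [Pi.add_apply] <;> rcases e.symm i with a | a | a <;>
          simp only [realCoords, Pi.add_apply] <;> try split_ifs
        all_goals simp
      map_smul' := fun r p => by
        ext i <;> simp only [Pi.smul_apply] <;> rcases e.symm i with a | a | a <;>
          simp only [realCoords, Pi.smul_apply] <;> try split_ifs
        all_goals simp }

theorem build_apply (p : WilliamsonBlock ke kh kf → ℂ × ℂ) (q : WilliamsonIndex ke kh kf) :
    build e p (e q) = realCoords p q :=
  congrArg (realCoords p) (e.symm_apply_apply q)

theorem sum_form (u v : Fin n → ℝ × ℝ) :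
    ∑ b, (starRingEnd ℂ (fst e b u) * snd e b v - starRingEnd ℂ (fst e b v) * snd e b u).re =
      symplForm u v := by
  rw [symplForm, ← e.sum_comp]
  simp only [Fintype.sum_sum_type, Fintype.sum_prod_type, Fin.sum_univ_two]
  congr 1
  · refine Finset.sum_congr rfl fun a _ => ?_
    simp [fst, snd, Complex.mul_re, Complex.mul_im]
    ring
  congr 1
  · refine Finset.sum_congr rfl fun a _ => ?_
    simp [fst, snd]
    ring
  · refine Finset.sum_congr rfl fun a _ => ?_
    simp [fst, snd]
    ring

end WilliamsonIndex

theorem eq_zero_of_symplForm_eq_zero {u : Fin n → ℝ × ℝ} (h : ∀ v, symplForm u v = 0) : u = 0 := by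
  have h1 := h fun i => (-(u i).2, (u i).1)
  have h2 : ∀ i ∈ Finset.univ, 0 ≤ (u i).1 * (u i).1 - (u i).2 * -(u i).2 := fun i _ => by
    nlinarith [mul_self_nonneg (u i).1, mul_self_nonneg (u i).2]
  ext i
  all_goals
    have h3 := (Finset.sum_eq_zero_iff_of_nonneg h2).1 h1 i (Finset.mem_univ i)
    have h4 : (u i).1 * (u i).1 + (u i).2 * (u i).2 = 0 := by linarith
    have h5 := mul_self_add_mul_self_eq_zero.1 h4
    simp [h5.1, h5.2]

/-- The block model of a fixed point of Williamson type `(ke, kh, kf)`. -/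
noncomputable def williamsonModel (e : WilliamsonIndex ke kh kf ≃ Fin n) :
    BlockModel (WilliamsonBlock ke kh kf) (Fin n → ℝ × ℝ) where
  kind := WilliamsonIndex.kind
  fst := WilliamsonIndex.fst e
  snd := WilliamsonIndex.snd e
  build := WilliamsonIndex.build e
  build_coords z := by
    funext i
    obtain ⟨q, rfl⟩ := e.surjective i
    rw [WilliamsonIndex.build_apply]
    rcases q with a | a | ⟨a, r⟩
    · simp [WilliamsonIndex.realCoords, WilliamsonIndex.fst]
    · simp [WilliamsonIndex.realCoords, WilliamsonIndex.fst, WilliamsonIndex.snd]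
    · fin_cases r <;> simp [WilliamsonIndex.realCoords, WilliamsonIndex.fst, WilliamsonIndex.snd]
  compat b z := by
    rcases b with a | a | a
    · rfl
    · exact ⟨rfl, rfl⟩
    · trivial
  coords_build p hp b := by
    have h := hp b
    rcases b with a | a | a
    · simp only [WilliamsonIndex.kind, BlockKind.Compat] at h
      have h1 : WilliamsonIndex.fst e (.inl a) (WilliamsonIndex.build e p) = (p (.inl a)).1 := by
        simp [WilliamsonIndex.fst, WilliamsonIndex.build_apply, WilliamsonIndex.realCoords]
      refine Prod.ext h1 ?_
      rw [h, ← h1]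
      rfl
    · obtain ⟨h1, h2⟩ := h
      refine Prod.ext (Complex.ext ?_ ?_) (Complex.ext ?_ ?_) <;>
        simp [WilliamsonIndex.fst, WilliamsonIndex.snd, WilliamsonIndex.build_apply,
          WilliamsonIndex.realCoords, h1, h2]
    · refine Prod.ext (Complex.ext ?_ ?_) (Complex.ext ?_ ?_) <;>
        simp [WilliamsonIndex.fst, WilliamsonIndex.snd, WilliamsonIndex.build_apply,
          WilliamsonIndex.realCoords]
  nondeg u h := eq_zero_of_symplForm_eq_zero fun v =>
    (WilliamsonIndex.sum_form e u v).symm.trans (h v)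

theorem form_williamsonModel (e : WilliamsonIndex ke kh kf ≃ Fin n) (u v : Fin n → ℝ × ℝ) :
    (williamsonModel e).form u v = symplForm u v :=
  WilliamsonIndex.sum_form e u v

theorem moment_williamsonModel_eq_iff (hn : n = ke + kh + 2 * kf) (z w : Fin n → ℝ × ℝ) :
    (∀ b, (williamsonModel (WilliamsonIndex.equivFin hn)).moment b w =
      (williamsonModel (WilliamsonIndex.equivFin hn)).moment b z) ↔
    ∀ i, williamson ke kh i w = williamson ke kh i z := by
  set e := WilliamsonIndex.equivFin hn
  have hinl : ∀ a z, williamson ke kh (e (.inl a)) z =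
      (z (e (.inl a))).1 ^ 2 + (z (e (.inl a))).2 ^ 2 := fun a z =>
    williamson_of_lt z a.2
  have hmid : ∀ a z, williamson ke kh (e (.inr (.inl a))) z =
      (z (e (.inr (.inl a)))).1 * (z (e (.inr (.inl a)))).2 := fun a z =>
    williamson_of_le_of_lt z (Nat.le_add_right _ _) (Nat.add_lt_add_left a.2 _)
  have h0 : ∀ a : Fin kf, (e (.inr (.inr (a, 0)))).val = ke + kh + 2 * a := fun a => rfl
  have h1 : ∀ a : Fin kf, (e (.inr (.inr (a, 1)))).val = ke + kh + 2 * a + 1 := fun a => rfl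
  have heven : ∀ a z, williamson ke kh (e (.inr (.inr (a, 0)))) z =
      (z (e (.inr (.inr (a, 0))))).1 * (z (e (.inr (.inr (a, 1))))).2 -
        (z (e (.inr (.inr (a, 1))))).1 * (z (e (.inr (.inr (a, 0))))).2 := fun a z =>
    williamson_of_even z (by rw [h0]; omega) (by rw [h0]; omega) (by rw [h0, h1])
  have hodd : ∀ a z, williamson ke kh (e (.inr (.inr (a, 1)))) z =
      (z (e (.inr (.inr (a, 0))))).1 * (z (e (.inr (.inr (a, 0))))).2 +
        (z (e (.inr (.inr (a, 1))))).1 * (z (e (.inr (.inr (a, 1))))).2 := fun a z =>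
    williamson_of_odd z (by rw [h0]; omega) (by rw [h0]; omega) (by rw [h0, h1])
  have kinl : ∀ a z, (williamsonModel e).moment (.inl a) z =
      -(Complex.I / 2) * (williamson ke kh (e (.inl a)) z : ℝ) := fun a z => by
    rw [hinl, sq, sq]
    apply Complex.ext <;>
      simp [BlockModel.moment, williamsonModel, WilliamsonIndex.fst, WilliamsonIndex.snd] <;> ring
  have kmid : ∀ a z, (williamsonModel e).moment (.inr (.inl a)) z =
      (williamson ke kh (e (.inr (.inl a))) z : ℝ) := fun a z => by
    rw [hmid]
    apply Complex.ext <;>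
      simp [BlockModel.moment, williamsonModel, WilliamsonIndex.fst, WilliamsonIndex.snd]
  have kinr : ∀ a z, (williamsonModel e).moment (.inr (.inr a)) z =
      ⟨williamson ke kh (e (.inr (.inr (a, 1)))) z,
        williamson ke kh (e (.inr (.inr (a, 0)))) z⟩ := fun a z => by
    rw [hodd, heven]
    apply Complex.ext <;>
      simp [BlockModel.moment, williamsonModel, WilliamsonIndex.fst, WilliamsonIndex.snd]
    ring
  constructor
  · intro h i
    obtain ⟨q, rfl⟩ := e.surjective i
    rcases q with a | a | ⟨a, r⟩
    · have := h (.inl a)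
      rw [kinl, kinl] at this
      simpa using this
    · have := h (.inr (.inl a))
      rw [kmid, kmid] at this
      exact_mod_cast this
    · have := h (.inr (.inr a))
      rw [kinr, kinr, Complex.mk.injEq] at this
      fin_cases r
      exacts [this.2, this.1]
  · intro h b
    rcases b with a | a | a
    · rw [kinl, kinl, h]
    · rw [kmid, kmid, h]
    · rw [kinr, kinr, h, h]

end model

end linearization

/-- Equivariant linearization of a compact symmetry group at a
nondegenerate fixed point, preserving the system: let `G` be a compact (Lie) group
acting smoothly on `ℝ^{2n}` fixing `0`, by system-preserving symplectomorphisms of the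
model system `h` of Williamson type `(k_e,k_h,k_f)`.  Then there is a local
system-preserving symplectic change of variables `Φ`, defined on a ball `B(0,ε)`, with
`Φ(0) = 0`, under which the action of `G` becomes linear:
`Φ(ρ(g)(z)) = D(ρ(g))(0)(Φ(z))`. -/
theorem equivariant_linearization_fixed_point
    (ke kh kf n : ℕ) (hn : n = ke + kh + 2 * kf)
    (G : Type*) [Group G] [TopologicalSpace G] [IsTopologicalGroup G] [CompactSpace G]
    (ρ : G → (Fin n → ℝ × ℝ) → (Fin n → ℝ × ℝ))
    (hcont : Continuous fun gz : G × (Fin n → ℝ × ℝ) => ρ gz.1 gz.2)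
    (hsmooth : ∀ g, ContDiff ℝ (⊤ : ℕ∞) (ρ g))
    (hone : ρ 1 = id)
    (hmul : ∀ g₁ g₂, ρ (g₁ * g₂) = ρ g₁ ∘ ρ g₂)
    (hfix : ∀ g, ρ g 0 = 0)
    (hsymp : ∀ g z, IsSymplecticCLM (fderiv ℝ (ρ g) z))
    (hpres : ∀ g z (i : Fin n), williamson ke kh i (ρ g z) = williamson ke kh i z) :
    ∃ ε > (0 : ℝ), ∃ Φ : (Fin n → ℝ × ℝ) → (Fin n → ℝ × ℝ),
      Φ 0 = 0 ∧
      ContDiffOn ℝ (⊤ : ℕ∞) Φ (Metric.ball 0 ε) ∧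
      Set.InjOn Φ (Metric.ball 0 ε) ∧
      (∀ z ∈ Metric.ball (0 : Fin n → ℝ × ℝ) ε, IsSymplecticCLM (fderiv ℝ Φ z)) ∧
      (∀ z ∈ Metric.ball (0 : Fin n → ℝ × ℝ) ε, ∀ i : Fin n,
        williamson ke kh i (Φ z) = williamson ke kh i z) ∧
      ∀ (g : G), ∀ z ∈ Metric.ball (0 : Fin n → ℝ × ℝ) ε,
        ρ g z ∈ Metric.ball (0 : Fin n → ℝ × ℝ) ε →
          Φ (ρ g z) = fderiv ℝ (ρ g) 0 (Φ z) := by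
  let M := williamsonModel (WilliamsonIndex.equivFin (ke := ke) (kh := kh) (kf := kf) hn)
  have hform : ∀ u v, M.form u v = symplForm u v := form_williamsonModel _
  have hρ : M.IsSymmetryAction ρ :=
    { continuous := hcont
      contDiff := hsmooth
      one := fun z => congrFun hone z
      mul := fun g h z => congrFun (hmul g h) z
      zero := hfix
      symp := fun g z v w => by rw [hform, hform, hsymp g z]
      moment := fun g b z => (moment_williamsonModel_eq_iff hn z (ρ g z)).2 (hpres g z) b }
  obtain ⟨Φ, h0, hsm, hinj, hΦ, hmom, heq⟩ := hρ.exists_linearization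
  refine ⟨1, one_pos, Φ, h0, hsm.contDiffOn, hinj.injOn, fun z _ v w => ?_, fun z _ => ?_,
    fun g z _ _ => heq g z⟩
  · rw [← hform, hΦ, hform]
  · exact (moment_williamsonModel_eq_iff hn z (Φ z)).1 fun b => hmom b z
end
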